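/- arXiv:2602.15347 — 4 statements merged into one kernel-verified Lean document; each statement's English description precedes it below -/
import Mathlib

section
/- Let d ≥ 2, n ≥ d+1, let C be the set of vertices of a d-dimensional convex polytope in E^d with |C| = n, and let r > 0 be such that P_{C,r} is a basic r-ball polyhedron with center-polytope conv(C). Let τ_1 < τ_2 < … < τ_n be real numbers and let M := {(τ_i, τ_i^2, …, τ_i^d) : 1 ≤ i ≤ n} ⊆ E^d be the corresponding points on the moment curve. Then for every 1 ≤ k ≤ d, f_{k−1}(P_{C,r}) is at most the number of (d−k)-dimensional exposed faces of the cyclic polytope conv(M). -/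
open Metric Set
open scoped RealInnerProductSpace

/-- The dimension of a set: the dimension of its affine span. -/
noncomputable def setDim {d : ℕ} (A : Set (EuclideanSpace ℝ (Fin d))) : ℕ :=
  Module.finrank ℝ (affineSpan ℝ A).direction

/-- The farthest-point Voronoi face `V_S`: the set of points whose set of farthest points
of `C` is exactly `S`. -/
def vorF {d : ℕ} (C S : Set (EuclideanSpace ℝ (Fin d))) : Set (EuclideanSpace ℝ (Fin d)) :=
  {x | S = {c | c ∈ C ∧ ∀ c' ∈ C, dist x c' ≤ dist x c}}

/-- `P_{C,r}`: the intersection of the closed balls of radius `r` centered at points of `C`. -/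
def ballPoly {d : ℕ} (C : Set (EuclideanSpace ℝ (Fin d))) (r : ℝ) :
    Set (EuclideanSpace ℝ (Fin d)) :=
  ⋂ c ∈ C, closedBall c r

/-- The `r`-convex hull of `X`. -/
def rConvexHull {d : ℕ} (r : ℝ) (X : Set (EuclideanSpace ℝ (Fin d))) :
    Set (EuclideanSpace ℝ (Fin d)) :=
  ⋂ x ∈ {x | X ⊆ closedBall x r}, closedBall x r

/-- `C` lies in `r`-convex position. -/
def RConvexPosition {d : ℕ} (r : ℝ) (C : Set (EuclideanSpace ℝ (Fin d))) : Prop :=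
  (∃ p, C ⊆ ball p r) ∧ ∀ c ∈ C, c ∉ rConvexHull r (C \ {c})

/-- `P_{C,r}` is a basic `r`-ball polyhedron with center-polytope `conv C`. -/
def IsBasicBallPolyhedron {d : ℕ} (C : Set (EuclideanSpace ℝ (Fin d))) (r : ℝ) : Prop :=
  0 < r ∧ C.Finite ∧ d + 1 ≤ C.ncard ∧ 2 ≤ d ∧
  setDim (convexHull ℝ C) = d ∧
  C = Set.extremePoints ℝ (convexHull ℝ C) ∧
  RConvexPosition r C ∧
  ∀ S ⊆ C, ∀ v, vorF C S = {v} → v ∈ interior (ballPoly C r)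

/-- `fFace C r k` is the number of `(k-1)`-dimensional faces of `P_{C,r}`, i.e. the number of
`S ⊆ C` with `V_S ∩ bd(P_{C,r}) ≠ ∅` and `dim V_S = k`. -/
noncomputable def fFace {d : ℕ} (C : Set (EuclideanSpace ℝ (Fin d))) (r : ℝ) (k : ℕ) : ℕ :=
  {S : Set (EuclideanSpace ℝ (Fin d)) | S ⊆ C ∧
    (vorF C S ∩ frontier (ballPoly C r)).Nonempty ∧ setDim (vorF C S) = k}.ncard

/-- The point `(t, t^2, ..., t^d)` of the moment curve in `E^d`. -/
noncomputable def momentPt (d : ℕ) (t : ℝ) : EuclideanSpace ℝ (Fin d) :=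
  (EuclideanSpace.equiv (Fin d) ℝ).symm (fun j => t ^ ((j : ℕ) + 1))

section LinearAlgebra

open Module Submodule

variable {E : Type*} [NormedAddCommGroup E] [InnerProductSpace ℝ E] {ι : Type*}
  {a : ι → E} {B : Finset ι} {c : E}

theorem Submodule.exists_inner_eq_one_of_notMem [FiniteDimensional ℝ E] {K : Submodule ℝ E}
    (hc : c ∉ K) :
    ∃ u, (∀ x ∈ K, ⟪x, u⟫ = 0) ∧ ⟪c, u⟫ = 1 := by
  rw [← K.orthogonal_orthogonal, Submodule.mem_orthogonal] at hc
  push Not at hc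
  obtain ⟨u, hu, hne⟩ := hc
  rw [Submodule.mem_orthogonal] at hu
  rw [real_inner_comm] at hne
  refine ⟨(⟪c, u⟫)⁻¹ • u, fun x hx => ?_, ?_⟩
  · rw [inner_smul_right, hu x hx, mul_zero]
  · rw [inner_smul_right, inv_mul_cancel₀ hne]

open Classical in
/-- The `i`-th vector of the basis dual to `(a j)_{j ∈ B}`. -/
noncomputable def dualVec (a : ι → E) (B : Finset ι) (i : ι) : E :=
  if h : ∃ u, ⟪a i, u⟫ = 1 ∧ ∀ j ∈ B, j ≠ i → ⟪a j, u⟫ = 0 then h.choose else 0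

theorem dualVec_spec [FiniteDimensional ℝ E] (hB : LinearIndepOn ℝ a B) {i : ι} (hi : i ∈ B) :
    ⟪a i, dualVec a B i⟫ = 1 ∧ ∀ j ∈ B, j ≠ i → ⟪a j, dualVec a B i⟫ = 0 := by
  have h : ∃ u, ⟪a i, u⟫ = 1 ∧ ∀ j ∈ B, j ≠ i → ⟪a j, u⟫ = 0 := by
    obtain ⟨u, hu, h1⟩ := Submodule.exists_inner_eq_one_of_notMem
      (hB.notMem_span (Finset.mem_coe.2 hi))
    exact ⟨u, h1, fun j hj hji => hu _ (subset_span ⟨j, ⟨hj, hji⟩, rfl⟩)⟩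
  rw [dualVec, dif_pos h]
  exact h.choose_spec

theorem sum_inner_dualVec_smul [FiniteDimensional ℝ E] (hB : LinearIndepOn ℝ a B)
    (hcard : B.card = finrank ℝ E) (c : E) :
    ∑ i ∈ B, ⟪c, dualVec a B i⟫ • a i = c := by
  have htop : span ℝ (a '' B) = ⊤ := by
    have := LinearIndependent.span_eq_top_of_card_eq_finrank' hB (by simpa using hcard)
    rwa [← Set.image_eq_range] at this
  have hc : c ∈ span ℝ (a '' B) := htop ▸ mem_top
  obtain ⟨μ, hμ⟩ := (Submodule.mem_span_image_finset_iff_exists_fun' (R := ℝ)).1 hc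
  subst hμ
  refine Finset.sum_congr rfl fun i hi => ?_
  rw [_root_.sum_inner, Finset.sum_eq_single_of_mem i hi]
  · rw [inner_smul_left, (dualVec_spec hB hi).1]; simp
  · intro j hj hji
    rw [inner_smul_left, (dualVec_spec hB hi).2 j hj hji, mul_zero]

theorem inner_eq_sum_dualVec [FiniteDimensional ℝ E] (hB : LinearIndepOn ℝ a B)
    (hcard : B.card = finrank ℝ E) (c z : E) :
    ⟪c, z⟫ = ∑ i ∈ B, ⟪c, dualVec a B i⟫ * ⟪a i, z⟫ := by
  conv_lhs => rw [← sum_inner_dualVec_smul hB hcard c]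
  rw [_root_.sum_inner]
  exact Finset.sum_congr rfl fun i _ => by rw [inner_smul_left]; simp

/-- `c` lies in no subspace spanned by fewer than `dim E` of the vectors `a i`. -/
def GenericDir (a : ι → E) (c : E) : Prop :=
  ∀ T : Finset ι, T.card < finrank ℝ E → c ∉ span ℝ (a '' T)

theorem span_ne_top_of_card_lt {T : Finset ι} (hT : T.card < finrank ℝ E) :
    span ℝ (a '' T) ≠ ⊤ := by
  classical
  intro h
  have h1 := finrank_span_finset_le_card (R := ℝ) (T.image a)
  rw [Finset.coe_image, Set.finrank, h, finrank_top] at h1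
  exact absurd (h1.trans Finset.card_image_le) (not_le.2 hT)

theorem exists_genericDir [Finite ι] (a : ι → E) : ∃ c, GenericDir a c := by
  classical
  cases nonempty_fintype ι
  have h := Subspace.biUnion_ne_univ_of_top_notMem (k := ℝ) (E := E)
    (s := Finset.image (fun T : Finset ι => span ℝ (a '' T))
      (Finset.univ.filter fun T : Finset ι => T.card < finrank ℝ E)) (by
      simp only [Finset.mem_image, Finset.mem_filter, Finset.mem_univ, true_and, not_exists,
        not_and]
      exact fun T hT => span_ne_top_of_card_lt hT)
  obtain ⟨c, hc⟩ := (Set.ne_univ_iff_exists_notMem _).1 h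
  refine ⟨c, fun T hT hmem => hc ?_⟩
  simp only [Set.mem_iUnion]
  exact ⟨_, Finset.mem_image.2 ⟨T, by simpa using hT, rfl⟩, hmem⟩

theorem GenericDir.neg (hc : GenericDir a c) : GenericDir a (-c) :=
  fun T hT h => hc T hT (by simpa using h)

theorem GenericDir.inner_dualVec_ne_zero [FiniteDimensional ℝ E] [DecidableEq ι]
    (hc : GenericDir a c) (hB : LinearIndepOn ℝ a B)
    (hcard : B.card = finrank ℝ E) {i : ι} (hi : i ∈ B) : ⟪c, dualVec a B i⟫ ≠ 0 := by
  intro h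
  refine hc (B.erase i) (by rw [← hcard]; exact Finset.card_erase_lt_of_mem hi) ?_
  rw [← sum_inner_dualVec_smul hB hcard c, ← Finset.sum_erase_add _ _ hi, h, zero_smul, add_zero]
  exact sum_mem fun j hj => smul_mem _ _ (subset_span ⟨j, hj, rfl⟩)

/-- Pushing a generic direction far along `-a f` can be done without losing genericity. -/
theorem GenericDir.exists_sub_smul [Finite ι] (hc : GenericDir a c) (f : ι) (K : ℝ) :
    ∃ M, K < M ∧ GenericDir a (c - M • a f) := by
  classical
  have hfin : (⋃ T ∈ {T : Finset ι | T.card < finrank ℝ E},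
      {M : ℝ | c - M • a f ∈ span ℝ (a '' T)}).Finite := by
    refine Set.Finite.biUnion (Set.toFinite _) fun T hT => Set.Subsingleton.finite ?_
    intro M (hM : _ ∈ span ℝ _) N (hN : _ ∈ span ℝ _)
    by_contra hne
    refine hc T hT ?_
    have h1 : (M - N) • a f ∈ span ℝ (a '' T) := by
      have := sub_mem hN hM
      rwa [show c - N • a f - (c - M • a f) = (M - N) • a f by rw [sub_smul]; abel] at this
    have h2 : a f ∈ span ℝ (a '' T) := by
      have := smul_mem _ (M - N)⁻¹ h1
      rwa [smul_smul, inv_mul_cancel₀ (sub_ne_zero.2 hne), one_smul] at this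
    have := add_mem hM (smul_mem _ M h2)
    simpa using this
  obtain ⟨M, hM, hM'⟩ := ((Set.Ioi_infinite K).sdiff hfin).nonempty
  refine ⟨M, hM, fun T hT h => hM' ?_⟩
  simp only [Set.mem_iUnion]
  exact ⟨T, hT, h⟩

end LinearAlgebra

section Polyhedra

open Module Submodule Filter Topology

variable {E : Type*} [NormedAddCommGroup E] [InnerProductSpace ℝ E]
  {ι : Type*} {a : ι → E} {b : ι → ℝ} {c : E}

/-- Some point of the polyhedron `{y | ∀ i, ⟪a i, y⟫ ≤ b i}` has `S` as its set of tight
constraints. -/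
def IsFace (a : ι → E) (b : ι → ℝ) (S : Finset ι) : Prop :=
  ∃ y, (∀ i, ⟪a i, y⟫ ≤ b i) ∧ ∀ i, ⟪a i, y⟫ = b i ↔ i ∈ S

/-- The polyhedron `{y | ∀ i, ⟪a i, y⟫ ≤ b i}` is bounded and simple. -/
structure IsSimpleSystem (a : ι → E) (b : ι → ℝ) : Prop where
  pos : ∀ z ≠ 0, ∃ i, 0 < ⟪a i, z⟫
  indep : ∀ S, IsFace a b S → LinearIndepOn ℝ a S

theorem exists_pos_mul_norm_le_sum [Fintype ι] [FiniteDimensional ℝ E]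
    (pos : ∀ z ≠ 0, ∃ i, 0 < ⟪a i, z⟫) :
    ∃ δ > 0, ∀ z, δ * ‖z‖ ≤ ∑ i, max 0 ⟪a i, z⟫ := by
  rcases subsingleton_or_nontrivial E with h | h
  · exact ⟨1, one_pos, fun z => by simp [Subsingleton.elim z 0]⟩
  have hcont : Continuous fun z : E => ∑ i, max 0 ⟪a i, z⟫ := by fun_prop
  obtain ⟨z₀, hz₀, hmin⟩ := (isCompact_sphere (0 : E) 1).exists_isMinOn
    (NormedSpace.sphere_nonempty.2 zero_le_one) hcont.continuousOn
  have hne : z₀ ≠ 0 := by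
    rintro rfl
    simp at hz₀
  refine ⟨∑ i, max 0 ⟪a i, z₀⟫, ?_, fun z => ?_⟩
  · obtain ⟨i, hi⟩ := pos z₀ hne
    exact Finset.sum_pos' (fun _ _ => le_max_left _ _) ⟨i, Finset.mem_univ i, lt_max_of_lt_right hi⟩
  · rcases eq_or_ne z 0 with rfl | hz
    · simp
    have hz' : ‖z‖ ≠ 0 := norm_ne_zero_iff.2 hz
    have h1 : ∑ i, max 0 ⟪a i, z₀⟫ ≤ ∑ i, max 0 ⟪a i, ‖z‖⁻¹ • z⟫ :=
      hmin (by simp [norm_smul, hz'])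
    calc _ ≤ (∑ i, max 0 ⟪a i, ‖z‖⁻¹ • z⟫) * ‖z‖ := by gcongr
      _ = _ := by
        rw [Finset.sum_mul]
        refine Finset.sum_congr rfl fun i _ => ?_
        rw [max_mul_of_nonneg _ _ (norm_nonneg z), zero_mul, inner_smul_right]
        field_simp

theorem isCompact_polyhedron [Fintype ι] [FiniteDimensional ℝ E]
    (pos : ∀ z ≠ 0, ∃ i, 0 < ⟪a i, z⟫) (b : ι → ℝ) :
    IsCompact {y | ∀ i, ⟪a i, y⟫ ≤ b i} := by
  obtain ⟨δ, hδ, h⟩ := exists_pos_mul_norm_le_sum pos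
  refine Metric.isCompact_of_isClosed_isBounded ?_ ?_
  · rw [Set.ofPred_forall]
    exact isClosed_iInter fun i => isClosed_le (by fun_prop) continuous_const
  · refine (Metric.isBounded_closedBall (x := (0 : E)) (r := (∑ i, max 0 (b i)) / δ)).subset ?_
    intro y hy
    rw [mem_closedBall_zero_iff, le_div_iff₀ hδ, mul_comm]
    exact (h y).trans (Finset.sum_le_sum fun i _ => max_le_max le_rfl (hy i))

/-- Moving from a point of the polyhedron a little bit in a feasible direction. -/
theorem exists_pos_move [Finite ι] {T : Finset ι} {y u : E} (hy : ∀ i, ⟪a i, y⟫ ≤ b i)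
    (hT : ∀ i, ⟪a i, y⟫ = b i ↔ i ∈ T) (hu : ∀ i ∈ T, ⟪a i, u⟫ ≤ 0) :
    ∃ ε > (0 : ℝ), (∀ i, ⟪a i, y + ε • u⟫ ≤ b i) ∧
      ∀ i, ⟪a i, y + ε • u⟫ = b i ↔ i ∈ T ∧ ⟪a i, u⟫ = 0 := by
  have key : ∀ i, ∀ᶠ ε in 𝓝[>] (0 : ℝ), ⟪a i, y + ε • u⟫ ≤ b i ∧
      (⟪a i, y + ε • u⟫ = b i ↔ i ∈ T ∧ ⟪a i, u⟫ = 0) := by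
    intro i
    by_cases hi : i ∈ T
    · filter_upwards [self_mem_nhdsWithin] with ε (hε : 0 < ε)
      have h1 := (hT i).2 hi
      have h2 := hu i hi
      rw [inner_add_right, inner_smul_right, h1]
      refine ⟨by nlinarith, ⟨fun h => ⟨hi, ?_⟩, fun h => by rw [h.2]; ring⟩⟩
      have h3 : ε * ⟪a i, u⟫ = 0 := by linarith
      exact (mul_eq_zero.1 h3).resolve_left hε.ne'
    · have hlt : ⟪a i, y⟫ < b i := lt_of_le_of_ne (hy i) fun h => hi ((hT i).1 h)
      have hcont : Tendsto (fun ε : ℝ => ⟪a i, y + ε • u⟫) (𝓝 0) (𝓝 ⟪a i, y⟫) := by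
        have : Continuous fun ε : ℝ => ⟪a i, y + ε • u⟫ := by fun_prop
        simpa using this.tendsto 0
      filter_upwards [(hcont.eventually (gt_mem_nhds hlt)).filter_mono nhdsWithin_le_nhds]
        with ε hε
      exact ⟨hε.le, ⟨fun h => absurd h hε.ne, fun h => absurd h.1 hi⟩⟩
  obtain ⟨ε, hε, hpos⟩ := ((eventually_all.2 key).and self_mem_nhdsWithin).exists
  exact ⟨ε, hpos, fun i => (hε i).1, fun i => (hε i).2⟩

/-- The constraints of the basis `B` that have a positive multiplier in the expansion of `c`. -/
noncomputable def up (a : ι → E) (B : Finset ι) (c : E) : Finset ι :=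
  B.filter fun i => 0 < ⟪c, dualVec a B i⟫

theorem up_subset (a : ι → E) (B : Finset ι) (c : E) : up a B c ⊆ B := Finset.filter_subset _ _

variable [FiniteDimensional ℝ E] [DecidableEq ι]

theorem IsSimpleSystem.isFace_of_subset [Finite ι] (hs : IsSimpleSystem a b) {S B : Finset ι}
    (hB : IsFace a b B) (hSB : S ⊆ B) : IsFace a b S := by
  have hind := hs.indep B hB
  obtain ⟨y, hy, hyB⟩ := hB
  have hu : ∀ i ∈ B, ⟪a i, -∑ j ∈ B \ S, dualVec a B j⟫ = if i ∈ S then 0 else -1 := by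
    intro i hi
    rw [inner_neg_right, inner_sum]
    split_ifs with h
    · rw [neg_eq_zero]
      refine Finset.sum_eq_zero fun j hj => (dualVec_spec hind (Finset.mem_sdiff.1 hj).1).2 i hi ?_
      rintro rfl
      exact (Finset.mem_sdiff.1 hj).2 h
    · rw [Finset.sum_eq_single_of_mem i (Finset.mem_sdiff.2 ⟨hi, h⟩), (dualVec_spec hind hi).1]
      intro j hj hji
      exact (dualVec_spec hind (Finset.mem_sdiff.1 hj).1).2 i hi hji.symm
  obtain ⟨ε, -, h1, h2⟩ := exists_pos_move hy hyB (u := -∑ j ∈ B \ S, dualVec a B j)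
    (fun i hi => by rw [hu i hi]; split_ifs <;> norm_num)
  refine ⟨_, h1, fun i => (h2 i).trans ⟨fun h => ?_, fun h => ⟨hSB h, by simp [hu i (hSB h), h]⟩⟩⟩
  by_contra hi
  simp [hu i h.1, hi] at h

/-- Each face of a simple polytope has a maximal vertex in a generic direction. -/
theorem IsSimpleSystem.exists_vertex [Fintype ι] (hs : IsSimpleSystem a b) (hc : GenericDir a c)
    {S : Finset ι} (hS : IsFace a b S) :
    ∃ B, IsFace a b B ∧ B.card = finrank ℝ E ∧ S ⊆ B ∧ B \ S ⊆ up a B c := by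
  obtain ⟨y₀, hy₀, hyS⟩ := hS
  have hcompact : IsCompact ({y | ∀ i, ⟪a i, y⟫ ≤ b i} ∩ {y | ∀ i ∈ S, ⟪a i, y⟫ = b i}) := by
    refine (isCompact_polyhedron hs.pos b).inter_right ?_
    simp only [Set.ofPred_forall]
    exact isClosed_iInter fun i => isClosed_iInter fun _ => isClosed_eq (by fun_prop)
      continuous_const
  obtain ⟨y, ⟨hy, hyS'⟩, hmax⟩ := hcompact.exists_isMaxOn ⟨y₀, hy₀, fun i hi => (hyS i).2 hi⟩
    (f := fun y => ⟪c, y⟫) (by fun_prop)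
  obtain ⟨B, hB⟩ : ∃ B : Finset ι, ∀ i, ⟪a i, y⟫ = b i ↔ i ∈ B := by
    classical
    exact ⟨Finset.univ.filter fun i => ⟪a i, y⟫ = b i, by simp⟩
  have hSB : S ⊆ B := fun i hi => (hB i).1 (hyS' i hi)
  have hface : IsFace a b B := ⟨y, hy, hB⟩
  have hind := hs.indep B hface
  have hno : ∀ u, (∀ i ∈ B, ⟪a i, u⟫ ≤ 0) → (∀ i ∈ S, ⟪a i, u⟫ = 0) → ⟪c, u⟫ ≤ 0 := by
    intro u hu huS
    obtain ⟨ε, hε, h1, h2⟩ := exists_pos_move hy hB hu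
    have := hmax (a := y + ε • u) ⟨h1, fun i hi => (h2 i).2 ⟨hSB hi, huS i hi⟩⟩
    simp only [Set.mem_ofPred_eq, inner_add_right, inner_smul_right] at this
    by_contra! hpos
    nlinarith
  have hmem : c ∈ span ℝ (a '' B) := by
    by_contra hc'
    obtain ⟨u, hu, hcu⟩ := Submodule.exists_inner_eq_one_of_notMem hc'
    have hu' : ∀ i ∈ B, ⟪a i, u⟫ = 0 := fun i hi => hu _ (subset_span ⟨i, hi, rfl⟩)
    have := hno u (fun i hi => (hu' i hi).le) fun i hi => hu' i (hSB hi)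
    linarith
  have hcard : B.card = finrank ℝ E := by
    refine le_antisymm ?_ (not_lt.1 fun h => hc B h hmem)
    simpa using LinearIndependent.fintype_card_le_finrank hind
  refine ⟨B, hface, hcard, hSB, fun i hi => ?_⟩
  obtain ⟨hiB, hiS⟩ := Finset.mem_sdiff.1 hi
  refine Finset.mem_filter.2 ⟨hiB, lt_of_le_of_ne ?_ (hc.inner_dualVec_ne_zero hind hcard hiB).symm⟩
  have := hno (-dualVec a B i) (fun j hj => ?_) fun j hj => ?_
  · simpa using this
  · rw [inner_neg_right]
    rcases eq_or_ne j i with rfl | hji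
    · rw [(dualVec_spec hind hj).1]; norm_num
    · rw [(dualVec_spec hind hiB).2 j hj hji]; norm_num
  · rw [inner_neg_right, (dualVec_spec hind hiB).2 j (hSB hj) (by rintro rfl; exact hiS hj),
      neg_zero]

/-- The maximal vertex of a face of a simple polytope is unique. -/
theorem IsSimpleSystem.vertex_subset (hs : IsSimpleSystem a b) {S B B' : Finset ι}
    (hB : IsFace a b B) (hcard : B.card = finrank ℝ E) (hSB : S ⊆ B) (hup : B \ S ⊆ up a B c)
    (hB' : IsFace a b B') (hcard' : B'.card = finrank ℝ E) (hSB' : S ⊆ B')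
    (hup' : B' \ S ⊆ up a B' c) : B ⊆ B' := by
  have hind := hs.indep B hB
  have hind' := hs.indep B' hB'
  obtain ⟨y, hy, hyB⟩ := hB
  obtain ⟨y', hy', hyB'⟩ := hB'
  have hle : ∀ i ∈ B', ⟪c, dualVec a B' i⟫ * ⟪a i, y⟫ ≤ ⟪c, dualVec a B' i⟫ * ⟪a i, y'⟫ := by
    intro i hi
    by_cases hiS : i ∈ S
    · rw [(hyB i).2 (hSB hiS), (hyB' i).2 hi]
    · have := (Finset.mem_filter.1 (hup' (Finset.mem_sdiff.2 ⟨hi, hiS⟩))).2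
      rw [(hyB' i).2 hi]
      exact mul_le_mul_of_nonneg_left (hy i) this.le
  have hle' : ∀ i ∈ B, ⟪c, dualVec a B i⟫ * ⟪a i, y'⟫ ≤ ⟪c, dualVec a B i⟫ * ⟪a i, y⟫ := by
    intro i hi
    by_cases hiS : i ∈ S
    · rw [(hyB i).2 hi, (hyB' i).2 (hSB' hiS)]
    · have := (Finset.mem_filter.1 (hup (Finset.mem_sdiff.2 ⟨hi, hiS⟩))).2
      rw [(hyB i).2 hi]
      exact mul_le_mul_of_nonneg_left (hy' i) this.le
  have h1 : ⟪c, y⟫ ≤ ⟪c, y'⟫ := by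
    rw [inner_eq_sum_dualVec hind' hcard' c y, inner_eq_sum_dualVec hind' hcard' c y']
    exact Finset.sum_le_sum hle
  have h2 : ⟪c, y'⟫ ≤ ⟪c, y⟫ := by
    rw [inner_eq_sum_dualVec hind hcard c y, inner_eq_sum_dualVec hind hcard c y']
    exact Finset.sum_le_sum hle'
  have heq := le_antisymm h2 h1
  rw [inner_eq_sum_dualVec hind hcard c y, inner_eq_sum_dualVec hind hcard c y',
    Finset.sum_eq_sum_iff_of_le hle'] at heq
  intro i hi
  by_cases hiS : i ∈ S
  · exact hSB' hiS
  · have hpos := (Finset.mem_filter.1 (hup (Finset.mem_sdiff.2 ⟨hi, hiS⟩))).2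
    rw [← hyB', mul_left_cancel₀ hpos.ne' (heq i hi)]
    exact (hyB i).2 hi

end Polyhedra

section HVector

open Module

variable {E : Type*} [NormedAddCommGroup E] [InnerProductSpace ℝ E]
  {ι : Type*} {a : ι → E} {b : ι → ℝ} {c c' : E}

theorem card_up_neg [FiniteDimensional ℝ E] [DecidableEq ι] (hc : GenericDir a c)
    {B : Finset ι} (hB : LinearIndepOn ℝ a B) (hcard : B.card = finrank ℝ E) :
    (up a B (-c)).card = finrank ℝ E - (up a B c).card := by
  rw [← hcard, ← Finset.card_sdiff_of_subset (up_subset a B c)]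
  congr 1
  ext i
  simp only [up, Finset.mem_filter, Finset.mem_sdiff, inner_neg_left, not_and, not_lt]
  refine and_congr_right fun hi => ?_
  have := hc.inner_dualVec_ne_zero hB hcard hi
  exact ⟨fun h _ => by linarith, fun h => by linarith [lt_of_le_of_ne (h hi) this]⟩

variable [Fintype ι]

open Classical in
/-- The faces of a simple polyhedron of codimension `m`, given by their tight constraints. -/
noncomputable def faces (a : ι → E) (b : ι → ℝ) (m : ℕ) : Finset (Finset ι) :=
  Finset.univ.filter fun S => S.card = m ∧ IsFace a b S

theorem mem_faces {m : ℕ} {S : Finset ι} : S ∈ faces a b m ↔ S.card = m ∧ IsFace a b S := by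
  simp [faces]

/-- The `h`-vector of a simple polytope, read off from the generic direction `c`. -/
noncomputable def hnum (a : ι → E) (b : ι → ℝ) (c : E) (i : ℕ) : ℕ :=
  ((faces a b (finrank ℝ E)).filter fun B => (up a B c).card = i).card

theorem eq_of_sum_mul_choose_eq {d : ℕ} {h h' : ℕ → ℕ}
    (H : ∀ k ≤ d, ∑ i ∈ Finset.range (d + 1), h i * i.choose k =
      ∑ i ∈ Finset.range (d + 1), h' i * i.choose k) : ∀ i ≤ d, h i = h' i := by
  suffices ∀ j ≤ d, h (d - j) = h' (d - j) by
    intro i hi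
    simpa [Nat.sub_sub_self hi] using this (d - i) (Nat.sub_le _ _)
  intro j
  induction j using Nat.strong_induction_on with
  | _ j ih =>
    intro hj
    have h1 := H (d - j) (Nat.sub_le _ _)
    have hmem : d - j ∈ Finset.range (d + 1) := by simp
    rw [← Finset.add_sum_erase _ _ hmem, ← Finset.add_sum_erase _ _ hmem] at h1
    have h2 : ∀ i ∈ (Finset.range (d + 1)).erase (d - j),
        h i * i.choose (d - j) = h' i * i.choose (d - j) := by
      intro i hi
      simp only [Finset.mem_erase, Finset.mem_range] at hi
      rcases lt_or_gt_of_ne hi.1 with hlt | hgt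
      · simp [Nat.choose_eq_zero_of_lt hlt]
      · have := ih (d - i) (by omega) (by omega)
        rw [Nat.sub_sub_self (by omega)] at this
        rw [this]
    rw [Finset.sum_congr rfl h2] at h1
    simpa using h1

variable [FiniteDimensional ℝ E] [DecidableEq ι]

theorem IsSimpleSystem.card_faces_eq_sum_choose (hs : IsSimpleSystem a b) (hc : GenericDir a c)
    {k : ℕ} (hk : k ≤ finrank ℝ E) :
    (faces a b (finrank ℝ E - k)).card =
      ∑ B ∈ faces a b (finrank ℝ E), (up a B c).card.choose k := by
  simp only [← Finset.card_powersetCard, ← Finset.card_sigma]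
  refine (Finset.card_bij (fun p _ => p.1 \ p.2) ?_ ?_ ?_).symm
  · rintro ⟨B, U⟩ h
    simp only [Finset.mem_sigma, mem_faces, Finset.mem_powersetCard] at h ⊢
    obtain ⟨⟨hBc, hB⟩, hU, rfl⟩ := h
    exact ⟨by rw [Finset.card_sdiff_of_subset (hU.trans (up_subset a B c)), hBc],
      hs.isFace_of_subset hB Finset.sdiff_subset⟩
  · rintro ⟨B, U⟩ h ⟨B', U'⟩ h' heq
    simp only [Finset.mem_sigma, mem_faces, Finset.mem_powersetCard] at h h' heq
    obtain ⟨⟨hBc, hB⟩, hU, -⟩ := h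
    obtain ⟨⟨hBc', hB'⟩, hU', -⟩ := h'
    have hUB := hU.trans (up_subset a B c)
    have hUB' := hU'.trans (up_subset a B' c)
    have hd : B \ (B \ U) ⊆ up a B c := by rwa [Finset.sdiff_sdiff_eq_self hUB]
    have hd' : B' \ (B' \ U') ⊆ up a B' c := by rwa [Finset.sdiff_sdiff_eq_self hUB']
    have hBB' : B = B' := by
      refine Finset.eq_of_subset_of_card_le ?_ (by rw [hBc, hBc'])
      refine hs.vertex_subset hB hBc Finset.sdiff_subset hd hB' hBc' ?_ ?_
      · rw [heq]; exact Finset.sdiff_subset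
      · rwa [heq]
    subst hBB'
    rw [← Finset.sdiff_sdiff_eq_self hUB, heq, Finset.sdiff_sdiff_eq_self hUB']
  · intro S hS
    rw [mem_faces] at hS
    obtain ⟨B, hB, hBc, hSB, hup⟩ := hs.exists_vertex hc hS.2
    refine ⟨⟨B, B \ S⟩, ?_, Finset.sdiff_sdiff_eq_self hSB⟩
    simp only [Finset.mem_sigma, mem_faces, Finset.mem_powersetCard]
    refine ⟨⟨hBc, hB⟩, hup, ?_⟩
    rw [Finset.card_sdiff_of_subset hSB, hBc, hS.1, Nat.sub_sub_self hk]

theorem IsSimpleSystem.card_faces_eq_sum_hnum (hs : IsSimpleSystem a b) (hc : GenericDir a c)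
    {k : ℕ} (hk : k ≤ finrank ℝ E) :
    (faces a b (finrank ℝ E - k)).card =
      ∑ i ∈ Finset.range (finrank ℝ E + 1), hnum a b c i * i.choose k := by
  rw [hs.card_faces_eq_sum_choose hc hk, ← Finset.sum_fiberwise_of_maps_to
    (t := Finset.range (finrank ℝ E + 1)) (g := fun B => (up a B c).card)]
  · refine Finset.sum_congr rfl fun i _ => ?_
    rw [hnum, ← smul_eq_mul, ← Finset.sum_const]
    exact Finset.sum_congr rfl fun B hB => by rw [(Finset.mem_filter.1 hB).2]
  · intro B hB
    rw [Finset.mem_range, Nat.lt_succ_iff, ← (mem_faces.1 hB).1]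
    exact Finset.card_le_card (up_subset a B c)

theorem IsSimpleSystem.hnum_eq (hs : IsSimpleSystem a b) (hc : GenericDir a c)
    (hc' : GenericDir a c') {i : ℕ} (hi : i ≤ finrank ℝ E) : hnum a b c i = hnum a b c' i :=
  eq_of_sum_mul_choose_eq (fun _ hk => by
    rw [← hs.card_faces_eq_sum_hnum hc hk, ← hs.card_faces_eq_sum_hnum hc' hk]) i hi

/-- The Dehn-Sommerville equations. -/
theorem IsSimpleSystem.hnum_symm (hs : IsSimpleSystem a b) (hc : GenericDir a c) {i : ℕ}
    (hi : i ≤ finrank ℝ E) : hnum a b c (finrank ℝ E - i) = hnum a b c i := by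
  rw [hs.hnum_eq hc hc.neg (Nat.sub_le _ _), hnum, hnum]
  congr 1
  refine Finset.filter_congr fun B hB => ?_
  rw [mem_faces] at hB
  rw [card_up_neg hc (hs.indep B hB.2) hB.1]
  have := hB.1 ▸ Finset.card_le_card (up_subset a B c)
  omega

theorem IsSimpleSystem.hnum_finrank_le_one (hs : IsSimpleSystem a b) (hc : GenericDir a c) :
    hnum a b c (finrank ℝ E) ≤ 1 := by
  have h := hs.card_faces_eq_sum_hnum hc le_rfl
  rw [Finset.sum_range_succ, Nat.choose_self, mul_one, Nat.sub_self] at h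
  have h2 : (faces a b 0).card ≤ 1 := by
    rw [Finset.card_le_one]
    intro S hS T hT
    rw [mem_faces, Finset.card_eq_zero] at hS hT
    rw [hS.1, hT.1]
  omega

theorem IsSimpleSystem.hnum_zero_le_one (hs : IsSimpleSystem a b) (hc : GenericDir a c) :
    hnum a b c 0 ≤ 1 := by
  rw [← hs.hnum_symm hc (Nat.zero_le _)]
  exact hs.hnum_finrank_le_one hc

/-- The `h`-numbers of a facet are at most the `h`-numbers of the polytope. -/
theorem IsSimpleSystem.card_facet_le_hnum (hs : IsSimpleSystem a b) (hc : GenericDir a c) (f : ι)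
    {i : ℕ} (hi : i ≤ finrank ℝ E) :
    ((faces a b (finrank ℝ E)).filter fun B => f ∈ B ∧ ((up a B c).erase f).card = i).card ≤
      hnum a b c i := by
  obtain ⟨M, hM, hgen⟩ := hc.exists_sub_smul f (∑ B : Finset ι, |⟪c, dualVec a B f⟫|)
  rw [hs.hnum_eq hc hgen hi]
  refine Finset.card_le_card fun B hB => ?_
  rw [Finset.mem_filter] at hB ⊢
  obtain ⟨hBf, hfB, hcard⟩ := hB
  refine ⟨hBf, ?_⟩
  rw [← hcard]
  congr 1
  have hind := hs.indep B (mem_faces.1 hBf).2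
  ext j
  simp only [up, Finset.mem_filter, Finset.mem_erase, inner_sub_left, inner_smul_left,
    conj_trivial]
  rcases eq_or_ne j f with rfl | hne
  · rw [(dualVec_spec hind hfB).1]
    have : |⟪c, dualVec a B j⟫| ≤ ∑ B : Finset ι, |⟪c, dualVec a B j⟫| :=
      Finset.single_le_sum (f := fun B => |⟪c, dualVec a B j⟫|) (fun _ _ => abs_nonneg _)
        (Finset.mem_univ B)
    have h2 := le_abs_self ⟪c, dualVec a B j⟫
    simp only [mul_one, ne_eq, not_true_eq_false, false_and, iff_false, not_and, not_lt]
    intro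
    linarith
  · simp only [ne_eq, hne, not_false_eq_true, true_and]
    refine and_congr_right fun hj => ?_
    rw [(dualVec_spec hind hj).2 f hfB hne.symm, mul_zero, sub_zero]

theorem IsSimpleSystem.hnum_recurrence (hs : IsSimpleSystem a b) (hc : GenericDir a c) {i : ℕ}
    (hi : i ≤ finrank ℝ E) :
    (finrank ℝ E - i) * hnum a b c i + (i + 1) * hnum a b c (i + 1) ≤
      Fintype.card ι * hnum a b c i := by
  calc (finrank ℝ E - i) * hnum a b c i + (i + 1) * hnum a b c (i + 1)
      = ∑ B ∈ faces a b (finrank ℝ E), ((if (up a B c).card = i then finrank ℝ E - i else 0) +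
          if (up a B c).card = i + 1 then i + 1 else 0) := by
        rw [Finset.sum_add_distrib, ← Finset.sum_filter, ← Finset.sum_filter, Finset.sum_const,
          Finset.sum_const, smul_eq_mul, smul_eq_mul, hnum, hnum, mul_comm, mul_comm (i + 1)]
    _ ≤ ∑ B ∈ faces a b (finrank ℝ E),
          (Finset.univ.filter fun f => f ∈ B ∧ ((up a B c).erase f).card = i).card := by
        refine Finset.sum_le_sum fun B hB => ?_
        have hB' := (mem_faces.1 hB).1
        split_ifs with h1 h2 h2
        · omega
        · rw [add_zero, ← h1, ← hB', ← Finset.card_sdiff_of_subset (up_subset a B c)]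
          refine Finset.card_le_card fun f hf => ?_
          rw [Finset.mem_sdiff] at hf
          simp [hf.1, Finset.erase_eq_of_notMem hf.2]
        · rw [zero_add, ← h2]
          refine Finset.card_le_card fun f hf => ?_
          simp [up_subset a B c hf, Finset.card_erase_of_mem hf, h2]
        · exact Nat.zero_le _
    _ = ∑ f : ι, ((faces a b (finrank ℝ E)).filter
          fun B => f ∈ B ∧ ((up a B c).erase f).card = i).card := by
        simp only [Finset.card_filter]
        exact Finset.sum_comm
    _ ≤ ∑ _f : ι, hnum a b c i := Finset.sum_le_sum fun f _ => hs.card_facet_le_hnum hc f hi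
    _ = _ := by simp

theorem IsSimpleSystem.hnum_le_choose (hs : IsSimpleSystem a b) (hc : GenericDir a c) {N : ℕ}
    (hN : Fintype.card ι = N + finrank ℝ E + 1) {i : ℕ} (hi : i ≤ finrank ℝ E) :
    hnum a b c i ≤ (N + i).choose i := by
  induction i with
  | zero => simpa using hs.hnum_zero_le_one hc
  | succ i ih =>
    have hrec := hs.hnum_recurrence hc (i := i) (by omega)
    obtain ⟨e, he⟩ : ∃ e, finrank ℝ E = i + e := ⟨_, (Nat.add_sub_cancel' (by omega)).symm⟩
    have h1 : (i + 1) * hnum a b c (i + 1) ≤ (N + i + 1) * hnum a b c i := by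
      rw [hN, he, Nat.add_sub_cancel_left] at hrec
      nlinarith
    have h2 := Nat.add_one_mul_choose_eq (N + i) i
    have h3 : (i + 1) * hnum a b c (i + 1) ≤ (i + 1) * (N + i + 1).choose (i + 1) := by
      calc _ ≤ (N + i + 1) * hnum a b c i := h1
        _ ≤ (N + i + 1) * (N + i).choose i := Nat.mul_le_mul_left _ (ih (by omega))
        _ = _ := by rw [h2, mul_comm]
    exact Nat.le_of_mul_le_mul_left h3 (Nat.succ_pos i)

theorem sum_choose_mul_choose (N M s : ℕ) :
    ∑ j ∈ Finset.range (s + 1), (N + j).choose j * (M + (s - j)).choose (s - j) =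
      (N + M + 1 + s).choose s := by
  have h := congrArg (PowerSeries.coeff s) (congrArg Units.val
    (PowerSeries.invOneSubPow_add ℤ (N + 1) (M + 1)))
  rw [Units.val_mul, show N + 1 + (M + 1) = (N + M + 1) + 1 by ring] at h
  simp only [PowerSeries.invOneSubPow_val_succ_eq_mk_add_choose, PowerSeries.coeff_mul,
    PowerSeries.coeff_mk] at h
  rw [Finset.Nat.sum_antidiagonal_eq_sum_range_succ_mk] at h
  rw [← Nat.choose_symm_add (a := N + M + 1) (b := s)]
  simp only [← Nat.choose_symm_add (a := N), ← Nat.choose_symm_add (a := M)]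
  exact_mod_cast h.symm

/-- In a neighborly simple polytope the `h`-numbers are as large as possible. -/
theorem IsSimpleSystem.choose_le_hnum (hs : IsSimpleSystem a b) (hc : GenericDir a c) {N : ℕ}
    (hN : Fintype.card ι = N + finrank ℝ E + 1)
    (hnb : ∀ S : Finset ι, 2 * S.card ≤ finrank ℝ E → IsFace a b S) {s : ℕ}
    (hsd : 2 * s ≤ finrank ℝ E) : (N + s).choose s ≤ hnum a b c s := by
  obtain ⟨M, hM⟩ : ∃ M, finrank ℝ E = s + M := ⟨_, (Nat.add_sub_cancel' (by omega)).symm⟩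
  have h1 : (faces a b s).card = (Fintype.card ι).choose s := by
    rw [← Finset.card_univ, ← Finset.card_powersetCard]
    congr 1
    ext S
    rw [mem_faces, Finset.mem_powersetCard]
    exact ⟨fun h => ⟨Finset.subset_univ _, h.1⟩, fun h => ⟨h.2, hnb S (by omega)⟩⟩
  have h2 := hs.card_faces_eq_sum_hnum hc (k := M) (by omega)
  rw [show finrank ℝ E - M = s by omega, h1, ← Finset.sum_range_reflect] at h2
  have h3 : ∑ j ∈ Finset.range (finrank ℝ E + 1), hnum a b c (finrank ℝ E + 1 - 1 - j) *
      (finrank ℝ E + 1 - 1 - j).choose M =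
      ∑ j ∈ Finset.range (s + 1), hnum a b c j * (M + (s - j)).choose (s - j) := by
    rw [← Finset.sum_subset (Finset.range_mono (by omega : s + 1 ≤ finrank ℝ E + 1))]
    · refine Finset.sum_congr rfl fun j hj => ?_
      rw [Finset.mem_range] at hj
      rw [Nat.add_sub_cancel, hs.hnum_symm hc (by omega),
        show finrank ℝ E - j = M + (s - j) by omega, Nat.choose_symm_add]
    · intro j hj hj'
      rw [Finset.mem_range] at hj hj'
      rw [Nat.choose_eq_zero_of_lt (by omega), mul_zero]
  rw [h3, hN, hM, show N + (s + M) + 1 = N + M + 1 + s by ring, ← sum_choose_mul_choose,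
    Finset.sum_range_succ, Finset.sum_range_succ] at h2
  have h4 : ∑ j ∈ Finset.range s, hnum a b c j * (M + (s - j)).choose (s - j) ≤
      ∑ j ∈ Finset.range s, (N + j).choose j * (M + (s - j)).choose (s - j) := by
    refine Finset.sum_le_sum fun j hj => Nat.mul_le_mul_right _ (hs.hnum_le_choose hc hN ?_)
    rw [Finset.mem_range] at hj
    omega
  simp only [Nat.sub_self, Nat.choose_zero_right, mul_one] at h2
  omega

/-- The upper bound theorem for simple polytopes: a neighborly one has the most faces. -/
theorem IsSimpleSystem.card_faces_le {a' : ι → E} {b' : ι → ℝ} (hs : IsSimpleSystem a b)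
    (hs' : IsSimpleSystem a' b') (hcard : finrank ℝ E + 1 ≤ Fintype.card ι)
    (hnb : ∀ S : Finset ι, 2 * S.card ≤ finrank ℝ E → IsFace a' b' S) {m : ℕ}
    (hm : m ≤ finrank ℝ E) : (faces a b m).card ≤ (faces a' b' m).card := by
  obtain ⟨c, hc⟩ := exists_genericDir a
  obtain ⟨c', hc'⟩ := exists_genericDir a'
  obtain ⟨N, hN⟩ : ∃ N, Fintype.card ι = N + finrank ℝ E + 1 :=
    ⟨Fintype.card ι - (finrank ℝ E + 1), by omega⟩
  have hlow : ∀ i, 2 * i ≤ finrank ℝ E → hnum a b c i ≤ hnum a' b' c' i := fun i hi =>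
    (hs.hnum_le_choose hc hN (by omega)).trans (hs'.choose_le_hnum hc' hN hnb hi)
  have h1 := hs.card_faces_eq_sum_hnum hc (Nat.sub_le (finrank ℝ E) m)
  have h2 := hs'.card_faces_eq_sum_hnum hc' (Nat.sub_le (finrank ℝ E) m)
  rw [Nat.sub_sub_self hm] at h1 h2
  rw [h1, h2]
  refine Finset.sum_le_sum fun i hi => Nat.mul_le_mul_right _ ?_
  rw [Finset.mem_range] at hi
  by_cases h : 2 * i ≤ finrank ℝ E
  · exact hlow i h
  · rw [← hs.hnum_symm hc (by omega), ← hs'.hnum_symm hc' (by omega)]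
    exact hlow _ (by omega)

end HVector

section Perturbation

open Module Submodule Filter Topology

variable {E : Type*} [NormedAddCommGroup E] [InnerProductSpace ℝ E] {ι : Type*} {a : ι → E}

theorem exists_pos_forall_sum_mul_ne_zero [Fintype ι] {κ : Type*} [Finite κ] (μ : κ → ι → ℝ)
    (hμ : ∀ k, μ k ≠ 0) : ∃ g : ι → ℝ, (∀ i, 0 < g i) ∧ ∀ k, ∑ i, μ k i * g i ≠ 0 := by
  let e := Fintype.equivFin ι
  let p : κ → Polynomial ℝ := fun k => ∑ i, Polynomial.C (μ k i) * Polynomial.X ^ (e i : ℕ)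
  have hp : ∀ k, p k ≠ 0 := by
    intro k hk
    refine hμ k (funext fun i => ?_)
    have h := congrArg (fun q => Polynomial.coeff q (e i)) hk
    simp only [p, Polynomial.finsetSum_coeff, Polynomial.coeff_C_mul_X_pow,
      Polynomial.coeff_zero] at h
    rw [Finset.sum_eq_single_of_mem i (Finset.mem_univ i)] at h
    · simpa using h
    · intro j _ hji
      exact if_neg fun h => hji (e.injective (Fin.ext h)).symm
  have hfin : (⋃ k, {s : ℝ | (p k).IsRoot s}).Finite :=
    Set.finite_iUnion fun k => Polynomial.finite_setOfPred_isRoot (hp k)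
  obtain ⟨s, hs, hs'⟩ := ((Set.Ioi_infinite (0 : ℝ)).sdiff hfin).nonempty
  refine ⟨fun i => s ^ (e i : ℕ), fun i => pow_pos hs _, fun k hk => hs' ?_⟩
  rw [Set.mem_iUnion]
  exact ⟨k, by simpa [p, Polynomial.IsRoot, Polynomial.eval_finsetSum] using hk⟩

/-- A nonempty polyhedron `{z | ∀ i ∈ S, ⟪a i, z⟫ ≤ g i}` has a minimal face. -/
theorem exists_minimal_face [FiniteDimensional ℝ E] {g : ι → ℝ} (hg : ∀ i, 0 < g i)
    (S : Finset ι) :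
    ∃ z, ∃ S' ⊆ S, (∀ i ∈ S, ⟪a i, z⟫ ≤ g i) ∧ (∀ i ∈ S, ⟪a i, z⟫ = g i ↔ i ∈ S') ∧
      span ℝ (a '' S') = span ℝ (a '' S) := by
  classical
  let P : Finset ι → Prop := fun S' =>
    ∃ z, (∀ i ∈ S, ⟪a i, z⟫ ≤ g i) ∧ S' = S.filter fun i => ⟪a i, z⟫ = g i
  obtain ⟨S', hS', hmax⟩ := (S.powerset.filter P).exists_max_image Finset.card
    ⟨S.filter fun i => ⟪a i, (0 : E)⟫ = g i, by
      simp only [Finset.mem_filter, Finset.mem_powerset, Finset.filter_subset, true_and]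
      exact ⟨0, fun i _ => by simpa using (hg i).le, rfl⟩⟩
  rw [Finset.mem_filter, Finset.mem_powerset] at hS'
  obtain ⟨hsub, z, hz, hS'z⟩ := hS'
  refine ⟨z, S', hsub, hz, fun i hi => by simp [hS'z, hi], ?_⟩
  refine le_antisymm (span_mono (Set.image_mono hsub)) (span_le.2 ?_)
  rintro _ ⟨j, hj, rfl⟩
  by_contra hjn
  obtain ⟨u, hu, hju⟩ := Submodule.exists_inner_eq_one_of_notMem hjn
  have hu' : ∀ i ∈ S', ⟪a i, u⟫ = 0 := fun i hi => hu _ (subset_span ⟨i, hi, rfl⟩)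
  obtain ⟨l, hl, hmin⟩ := (S.filter fun i => 0 < ⟪a i, u⟫).exists_min_image
    (fun i => (g i - ⟪a i, z⟫) / ⟪a i, u⟫) ⟨j, Finset.mem_filter.2 ⟨hj, by rw [hju]; norm_num⟩⟩
  rw [Finset.mem_filter] at hl
  set t := (g l - ⟪a l, z⟫) / ⟪a l, u⟫ with ht
  have ht0 : 0 ≤ t := div_nonneg (sub_nonneg.2 (hz l hl.1)) hl.2.le
  have hz' : ∀ i ∈ S, ⟪a i, z + t • u⟫ ≤ g i := by
    intro i hi
    rw [inner_add_right, inner_smul_right]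
    by_cases hpos : 0 < ⟪a i, u⟫
    · have := hmin i (Finset.mem_filter.2 ⟨hi, hpos⟩)
      rw [le_div_iff₀ hpos] at this
      linarith
    · have := hz i hi
      nlinarith
  have hlt : S' ⊂ S.filter fun i => ⟪a i, z + t • u⟫ = g i := by
    refine (Finset.ssubset_iff_of_subset fun i hi => ?_).2 ⟨l, ?_, fun h => ?_⟩
    · refine Finset.mem_filter.2 ⟨hsub hi, ?_⟩
      rw [inner_add_right, inner_smul_right, hu' i hi, mul_zero, add_zero]
      rw [hS'z] at hi
      exact (Finset.mem_filter.1 hi).2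
    · refine Finset.mem_filter.2 ⟨hl.1, ?_⟩
      rw [inner_add_right, inner_smul_right, ht, div_mul_cancel₀ _ hl.2.ne']
      ring
    · exact hl.2.ne' (hu' l h)
  have := hmax (S.filter fun i => ⟪a i, z + t • u⟫ = g i) (by
    simp only [Finset.mem_filter, Finset.mem_powerset, Finset.filter_subset, true_and]
    exact ⟨_, hz', rfl⟩)
  exact absurd (Finset.card_lt_card hlt) (not_lt.2 this)

/-- Every bounded polyhedron can be perturbed to a simple one, each of the old faces giving rise to
a new face of the same dimension. -/
theorem exists_simple_perturbation [Fintype ι] [FiniteDimensional ℝ E]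
    (pos : ∀ z ≠ 0, ∃ i, 0 < ⟪a i, z⟫) (b : ι → ℝ) :
    ∃ b', IsSimpleSystem a b' ∧ ∀ S, IsFace a b S →
      ∃ S' ⊆ S, IsFace a b' S' ∧ span ℝ (a '' S') = span ℝ (a '' S) := by
  classical
  have hdep : ∀ A : {A : Finset ι // ¬ LinearIndepOn ℝ a A},
      ∃ μ : ι → ℝ, μ ≠ 0 ∧ (∀ i ∉ A.1, μ i = 0) ∧ ∑ i, μ i • a i = 0 := by
    rintro ⟨A, hA⟩
    obtain ⟨f, hf, i, hi, hfi⟩ := not_linearIndepOn_finset_iff.1 hA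
    refine ⟨fun j => if j ∈ A then f j else 0, fun h => hfi ?_, fun j hj => if_neg hj, ?_⟩
    · simpa [hi] using congrFun h i
    · simpa [ite_smul, Finset.sum_ite_mem] using hf
  choose μ hμ0 hμA hμa using hdep
  obtain ⟨g, hg, hgμ⟩ := exists_pos_forall_sum_mul_ne_zero μ hμ0
  have hloc : ∀ S : Finset ι, ∀ᶠ ε in 𝓝[>] (0 : ℝ), IsFace a b S →
      ∃ S' ⊆ S, IsFace a (fun i => b i + ε * g i) S' ∧ span ℝ (a '' S') = span ℝ (a '' S) := by
    intro S
    by_cases hS : IsFace a b S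
    swap
    · exact Eventually.of_forall fun _ h => absurd h hS
    obtain ⟨z, S', hsub, hz, hzS', hspan⟩ := exists_minimal_face (a := a) hg S
    obtain ⟨y, hy, hyS⟩ := hS
    have hout : ∀ i, ∀ᶠ ε in 𝓝[>] (0 : ℝ), i ∉ S → ⟪a i, y + ε • z⟫ < b i + ε * g i := by
      intro i
      by_cases hi : i ∈ S
      · exact Eventually.of_forall fun _ h => absurd hi h
      have hlt : ⟪a i, y⟫ < b i := lt_of_le_of_ne (hy i) fun h => hi ((hyS i).1 h)
      have h1 : Continuous fun ε : ℝ => ⟪a i, y + ε • z⟫ := by fun_prop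
      have h2 : Continuous fun ε : ℝ => b i + ε * g i := by fun_prop
      have h3 := (isOpen_lt h1 h2).mem_nhds (x := (0 : ℝ)) (by simpa using hlt)
      filter_upwards [nhdsWithin_le_nhds h3] with ε hε _ using hε
    filter_upwards [eventually_all.2 hout, self_mem_nhdsWithin] with ε hε (hε0 : 0 < ε) _
    refine ⟨S', hsub, ⟨y + ε • z, fun i => ?_, fun i => ?_⟩, hspan⟩
    · by_cases hi : i ∈ S
      · rw [inner_add_right, inner_smul_right, (hyS i).2 hi]
        have := mul_le_mul_of_nonneg_left (hz i hi) hε0.le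
        linarith
      · exact (hε i hi).le
    · by_cases hi : i ∈ S
      · rw [inner_add_right, inner_smul_right, (hyS i).2 hi, ← hzS' i hi, add_right_inj,
          mul_right_inj' hε0.ne']
      · exact ⟨fun h => absurd h (hε i hi).ne, fun h => absurd (hsub h) hi⟩
  obtain ⟨δ, hδ, hδ'⟩ := mem_nhdsGT_iff_exists_Ioo_subset.1 (eventually_all.2 hloc)
  have hfin : (⋃ A, {ε : ℝ | ∑ i, μ A i * (b i + ε * g i) = 0}).Finite := by
    refine Set.finite_iUnion fun A => Set.Subsingleton.finite fun ε hε ε' hε' => ?_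
    have hexp : ∀ ε : ℝ, ∑ i, μ A i * (b i + ε * g i) =
        ∑ i, μ A i * b i + ε * ∑ i, μ A i * g i := by
      intro ε
      rw [Finset.mul_sum, ← Finset.sum_add_distrib]
      exact Finset.sum_congr rfl fun i _ => by ring
    rw [Set.mem_ofPred_eq, hexp] at hε hε'
    exact mul_right_cancel₀ (hgμ A) (by linarith)
  obtain ⟨ε, hε, hε'⟩ := ((Set.Ioo_infinite (show (0 : ℝ) < δ from hδ)).sdiff hfin).nonempty
  refine ⟨fun i => b i + ε * g i, ⟨pos, fun A hA => ?_⟩, hδ' hε⟩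
  by_contra hAdep
  obtain ⟨y, -, hy⟩ := hA
  refine hε' (Set.mem_iUnion.2 ⟨⟨A, hAdep⟩, ?_⟩)
  have h := congrArg (fun x => ⟪x, y⟫) (hμa ⟨A, hAdep⟩)
  simp only [sum_inner, inner_smul_left, conj_trivial, inner_zero_left] at h
  rw [Set.mem_ofPred_eq, ← h]
  refine Finset.sum_congr rfl fun i _ => ?_
  by_cases hi : i ∈ A
  · rw [(hy i).2 hi]
  · rw [hμA ⟨A, hAdep⟩ i hi, zero_mul, zero_mul]

/-- The upper bound theorem: among the bounded polyhedra with a given number of facets, a neighborly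
simple one has the most faces. -/
theorem card_isFace_le [Fintype ι] [DecidableEq ι] [FiniteDimensional ℝ E] {a' : ι → E}
    {b' : ι → ℝ} (pos : ∀ z ≠ 0, ∃ i, 0 < ⟪a i, z⟫) (b : ι → ℝ) (hs' : IsSimpleSystem a' b')
    (hcard : finrank ℝ E + 1 ≤ Fintype.card ι)
    (hnb : ∀ S : Finset ι, 2 * S.card ≤ finrank ℝ E → IsFace a' b' S) {m : ℕ}
    (hm : m ≤ finrank ℝ E) :
    {S : Finset ι | IsFace a b S ∧ finrank ℝ (span ℝ (a '' S)) = m}.ncard ≤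
      (faces a' b' m).card := by
  obtain ⟨b'', hs, hb''⟩ := exists_simple_perturbation pos b
  refine le_trans ?_ (hs.card_faces_le hs' hcard hnb hm)
  choose! φ hφsub hφface hφspan using hb''
  rw [← Set.ncard_coe_finset]
  refine Set.ncard_le_ncard_of_injOn φ (fun S hS => ?_) ?_ (Set.toFinite _)
  · rw [Finset.mem_coe, mem_faces]
    refine ⟨?_, hφface S hS.1⟩
    rw [← hS.2, ← hφspan S hS.1, Set.image_eq_range]
    have := finrank_span_eq_card (hs.indep _ (hφface S hS.1))
    simpa using this.symm
  · have key : ∀ S T, IsFace a b S → IsFace a b T → φ S = φ T → S ⊆ T := by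
      intro S T hS hT h i hi
      have hmem : a i ∈ span ℝ (a '' φ S) := by
        rw [hφspan S hS]
        exact subset_span ⟨i, hi, rfl⟩
      have hsubS := hφsub S hS
      have hsubT := hφsub T hT
      obtain ⟨y, -, hyS⟩ := hS
      obtain ⟨z, -, hzT⟩ := hT
      obtain ⟨ν, hν⟩ := (mem_span_image_finset_iff_exists_fun' (R := ℝ)).1 hmem
      rw [← hzT, ← (hyS i).2 hi, ← hν, _root_.sum_inner, _root_.sum_inner]
      refine Finset.sum_congr rfl fun j hj => ?_
      rw [inner_smul_left, inner_smul_left, (hyS j).2 (hsubS hj), (hzT j).2 (hsubT (h ▸ hj))]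
    exact fun S hS T hT h => (key S T hS.1 hT.1 h).antisymm (key T S hT.1 hS.1 h.symm)

end Perturbation

section Cyclic

open Module Polynomial

variable {d : ℕ}

/-- The polynomial whose value at `t` is `c₀ + ⟪momentPt d t, y⟫`. -/
noncomputable def momentPoly (c₀ : ℝ) (y : EuclideanSpace ℝ (Fin d)) : ℝ[X] :=
  C c₀ + ∑ j : Fin d, C (y j) * X ^ ((j : ℕ) + 1)

theorem eval_momentPoly (c₀ : ℝ) (y : EuclideanSpace ℝ (Fin d)) (t : ℝ) :
    (momentPoly c₀ y).eval t = c₀ + ⟪momentPt d t, y⟫ := by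
  simp [momentPoly, eval_finsetSum, momentPt, PiLp.inner_apply]

theorem natDegree_momentPoly_le (c₀ : ℝ) (y : EuclideanSpace ℝ (Fin d)) :
    (momentPoly c₀ y).natDegree ≤ d := by
  refine natDegree_add_le_of_degree_le (by simp) (natDegree_sum_le_of_forall_le _ _ fun j _ => ?_)
  exact (natDegree_C_mul_X_pow_le _ _).trans j.2

theorem momentPoly_eq_zero {c₀ : ℝ} {y : EuclideanSpace ℝ (Fin d)} (h : momentPoly c₀ y = 0) :
    c₀ = 0 ∧ y = 0 := by
  have hc : ∀ m, (momentPoly c₀ y).coeff m = 0 := by simp [h]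
  refine ⟨by simpa [momentPoly] using hc 0, ?_⟩
  ext j
  have := hc (j + 1)
  simp only [momentPoly, coeff_add, coeff_C_succ, zero_add, finsetSum_coeff, coeff_C_mul_X_pow,
    Nat.add_right_cancel_iff] at this
  rw [Finset.sum_eq_single_of_mem j (Finset.mem_univ j)] at this
  · simpa using this
  · exact fun l _ hl => if_neg fun h => hl (Fin.ext h.symm)

theorem exists_momentPoly_eq {q : ℝ[X]} (hq : q.natDegree ≤ d) :
    ∃ c₀, ∃ y : EuclideanSpace ℝ (Fin d), ∀ t, q.eval t = c₀ + ⟪momentPt d t, y⟫ := by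
  refine ⟨q.coeff 0, (EuclideanSpace.equiv (Fin d) ℝ).symm fun j => q.coeff (j + 1), fun t => ?_⟩
  rw [eval_eq_sum_range' (Nat.lt_succ_of_le hq), Finset.sum_range_succ', Finset.sum_range]
  simp [momentPt, PiLp.inner_apply, add_comm]

variable {n : ℕ} {tau : Fin n → ℝ}

theorem eq_zero_of_momentPt (htau : Function.Injective tau) {c₀ : ℝ}
    {y : EuclideanSpace ℝ (Fin d)} {S : Finset (Fin n)} (hS : d < S.card)
    (h : ∀ i ∈ S, c₀ + ⟪momentPt d (tau i), y⟫ = 0) : c₀ = 0 ∧ y = 0 := by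
  classical
  refine momentPoly_eq_zero (eq_zero_of_natDegree_lt_card_of_eval_eq_zero' _ (S.image tau) ?_ ?_)
  · intro t ht
    obtain ⟨i, hi, rfl⟩ := Finset.mem_image.1 ht
    rw [eval_momentPoly, h i hi]
  · rw [Finset.card_image_of_injective _ htau]
    exact (natDegree_momentPoly_le _ _).trans_lt hS

theorem pos_of_sum_eq_zero {E ι : Type*} [NormedAddCommGroup E] [InnerProductSpace ℝ E]
    [Fintype ι] {a : ι → E} (hsum : ∑ i, a i = 0) (hspan : ∀ z, (∀ i, ⟪a i, z⟫ = 0) → z = 0) :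
    ∀ z ≠ 0, ∃ i, 0 < ⟪a i, z⟫ := by
  intro z hz
  by_contra! h
  refine hz (hspan z fun i => ?_)
  have h0 : ∑ i, ⟪a i, z⟫ = 0 := by rw [← sum_inner, hsum, inner_zero_left]
  exact (Finset.sum_eq_zero_iff_of_nonpos fun i _ => h i).1 h0 i (Finset.mem_univ i)

/-- The average of the points of a finite family. -/
noncomputable def average {E ι : Type*} [AddCommGroup E] [Module ℝ E] [Fintype ι] (p : ι → E) : E :=
  (Fintype.card ι : ℝ)⁻¹ • ∑ i, p i

theorem sum_sub_average {E ι : Type*} [AddCommGroup E] [Module ℝ E] [Fintype ι] [Nonempty ι]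
    (p : ι → E) : ∑ i, (p i - average p) = 0 := by
  rw [Finset.sum_sub_distrib, Finset.sum_const, Finset.card_univ, ← Nat.cast_smul_eq_nsmul ℝ,
    average, smul_inv_smul₀ (by simp), sub_self]

/-- The facet normals of the polar of the cyclic polytope, centered at its barycenter. -/
noncomputable def cyclicNormal (d : ℕ) (tau : Fin n → ℝ) (i : Fin n) : EuclideanSpace ℝ (Fin d) :=
  momentPt d (tau i) - average fun j => momentPt d (tau j)

theorem isSimpleSystem_cyclicNormal (htau : Function.Injective tau) (hn : d + 1 ≤ n) :
    IsSimpleSystem (cyclicNormal d tau) (fun _ => 1) where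
  pos := by
    have : Nonempty (Fin n) := ⟨⟨0, by omega⟩⟩
    refine pos_of_sum_eq_zero (sum_sub_average _) fun z hz => ?_
    refine (eq_zero_of_momentPt htau (S := Finset.univ)
      (c₀ := -⟪average fun j => momentPt d (tau j), z⟫) (by simpa using hn) fun i _ => ?_).2
    have := hz i
    rw [cyclicNormal, inner_sub_left] at this
    linarith
  indep := by
    rintro S ⟨y, -, hy⟩
    have hS : S.card ≤ d := by
      by_contra! hS
      obtain ⟨h1, rfl⟩ := eq_zero_of_momentPt htau
        (c₀ := -⟪average fun j => momentPt d (tau j), y⟫ - 1) (y := y) hS fun i hi => by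
          have := (hy i).2 hi
          rw [cyclicNormal, inner_sub_left] at this
          linarith
      simp at h1
    rw [linearIndepOn_finset_iff]
    intro f hf i hi
    have hf0 : ∑ j ∈ S, f j = 0 := by
      have := congrArg (fun x => ⟪x, y⟫) hf
      simp only [sum_inner, inner_smul_left, conj_trivial, inner_zero_left] at this
      rw [← this]
      exact Finset.sum_congr rfl fun j hj => by rw [(hy j).2 hj, mul_one]
    have hfp : ∑ j ∈ S, f j • momentPt d (tau j) = 0 := by
      simpa [cyclicNormal, smul_sub, Finset.sum_sub_distrib, ← Finset.sum_smul, hf0] using hf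
    obtain ⟨c₀, v, hv⟩ := exists_momentPoly_eq (d := d)
      (q := ∏ j ∈ S.erase i, (X - C (tau j))) (by
        rw [natDegree_finsetProd_X_sub_C_eq_card]
        exact (Finset.card_erase_le).trans hS)
    have h0 : ∑ j ∈ S, f j * (∏ l ∈ S.erase i, (X - C (tau l))).eval (tau j) = 0 := by
      have := congrArg (fun x => ⟪x, v⟫) hfp
      simp only [sum_inner, inner_smul_left, conj_trivial, inner_zero_left] at this
      simp only [hv, mul_add, Finset.sum_add_distrib, ← Finset.sum_mul, hf0, this, zero_mul,
        add_zero]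
    simp only [eval_prod, eval_sub, eval_X, eval_C] at h0
    rw [Finset.sum_eq_single_of_mem i hi] at h0
    · refine (mul_eq_zero.1 h0).resolve_right (Finset.prod_ne_zero_iff.2 fun l hl => ?_)
      exact sub_ne_zero.2 fun h => (Finset.mem_erase.1 hl).1 (htau h).symm
    · intro j hj hji
      rw [Finset.prod_eq_zero (Finset.mem_erase.2 ⟨hji, hj⟩) (sub_self _), mul_zero]

/-- Cyclic polytopes are neighborly. -/
theorem isFace_cyclicNormal (htau : Function.Injective tau) (hn : d + 1 ≤ n) {S : Finset (Fin n)}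
    (hS : 2 * S.card ≤ d) : IsFace (cyclicNormal d tau) (fun _ => 1) S := by
  set q : ℝ[X] := (∏ j ∈ S, (X - C (tau j))) ^ 2 with hq
  have hqz : ∀ i, q.eval (tau i) = 0 ↔ i ∈ S := by
    intro i
    simp only [hq, eval_pow, eval_prod, eval_sub, eval_X, eval_C, pow_eq_zero_iff two_ne_zero,
      Finset.prod_eq_zero_iff, sub_eq_zero]
    exact ⟨fun ⟨j, hj, h⟩ => htau h ▸ hj, fun h => ⟨i, h, rfl⟩⟩
  have hq0 : ∀ i, 0 ≤ q.eval (tau i) := fun i => by rw [hq, eval_pow]; positivity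
  obtain ⟨c₀, v, hv⟩ := exists_momentPoly_eq (d := d) (q := q) (by
    refine natDegree_pow_le.trans ?_
    rwa [natDegree_finsetProd_X_sub_C_eq_card])
  set w := average fun j => momentPt d (tau j) with hw
  have hn0 : (0 : ℝ) < n := by exact_mod_cast (by omega : 0 < n)
  have hκ : c₀ + ⟪w, v⟫ = (n : ℝ)⁻¹ * ∑ i, q.eval (tau i) := by
    simp only [hv, Finset.sum_add_distrib, Finset.sum_const, Finset.card_univ, Fintype.card_fin,
      nsmul_eq_mul, mul_add, inv_mul_cancel_left₀ hn0.ne', hw, average, inner_smul_left, sum_inner,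
      conj_trivial]
  have hκ0 : 0 < c₀ + ⟪w, v⟫ := by
    rw [hκ]
    refine mul_pos (inv_pos.2 hn0) (Finset.sum_pos' (fun i _ => hq0 i) ?_)
    obtain ⟨i, hi⟩ : ∃ i, i ∉ S := by
      by_contra! h
      have := Finset.card_le_card (fun i _ => h i : Finset.univ ⊆ S)
      rw [Finset.card_univ, Fintype.card_fin] at this
      omega
    exact ⟨i, Finset.mem_univ i, lt_of_le_of_ne (hq0 i) fun h => hi ((hqz i).1 h.symm)⟩
  have key : ∀ i, ⟪cyclicNormal d tau i, -(c₀ + ⟪w, v⟫)⁻¹ • v⟫ =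
      1 - q.eval (tau i) / (c₀ + ⟪w, v⟫) := by
    intro i
    rw [cyclicNormal, inner_smul_right, inner_sub_left, hv, ← hw]
    field_simp
    ring
  refine ⟨-(c₀ + ⟪w, v⟫)⁻¹ • v, fun i => ?_, fun i => ?_⟩
  · rw [key]
    linarith [div_nonneg (hq0 i) hκ0.le]
  · rw [key, sub_eq_self, div_eq_zero_iff, or_iff_left hκ0.ne', hqz]

end Cyclic

section ExposedFaces

open Module

variable {E ι : Type*} [NormedAddCommGroup E] [NormedSpace ℝ E] {p : ι → E} {l : StrongDual ℝ E}
  {β : ℝ}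

theorem le_of_mem_convexHull_range (hl : ∀ i, l (p i) ≤ β) {x : E}
    (hx : x ∈ convexHull ℝ (range p)) : l x ≤ β :=
  convexHull_min (t := {x | l x ≤ β}) (by rintro _ ⟨i, rfl⟩; exact hl i)
    (convex_halfSpace_le l.toLinearMap.isLinear β) hx

theorem eq_of_mem_convexHull_image {S : Set ι} (hl : ∀ i ∈ S, l (p i) = β) {x : E}
    (hx : x ∈ convexHull ℝ (p '' S)) : l x = β :=
  convexHull_min (t := {x | l x = β}) (by rintro _ ⟨i, hi, rfl⟩; exact hl i hi)
    (convex_hyperplane l.toLinearMap.isLinear β) hx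

theorem mem_convexHull_image_of_eq (hl : ∀ i, l (p i) ≤ β) {x : E}
    (hx : x ∈ convexHull ℝ (range p)) (hlx : l x = β) :
    x ∈ convexHull ℝ (p '' {i | l (p i) = β}) := by
  have hT : ∀ z ∈ convexHull ℝ (p '' {i | l (p i) = β}), l z = β := fun z hz =>
    eq_of_mem_convexHull_image (fun i hi => hi) hz
  have hU : convexHull ℝ (range p) ⊆ {x | l x < β ∨ x ∈ convexHull ℝ (p '' {i | l (p i) = β})} := by
    refine convexHull_min ?_ ?_
    · rintro _ ⟨i, rfl⟩
      rcases (hl i).lt_or_eq with h | h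
      · exact Or.inl h
      · exact Or.inr (subset_convexHull ℝ _ ⟨i, h, rfl⟩)
    · refine convex_iff_forall_pos.2 fun y hy z hz s t hs ht hst => ?_
      have hle : ∀ z, l z < β ∨ z ∈ convexHull ℝ (p '' {i | l (p i) = β}) → l z ≤ β := fun z hz =>
        hz.elim le_of_lt fun h => (hT z h).le
      have hlin : l (s • y + t • z) = s * l y + t * l z := by simp
      have hy' := hle y hy
      have hz' := hle z hz
      have hβ : β = s * β + t * β := by rw [← add_mul, hst, one_mul]
      rcases hy with hy | hy
      · left
        rw [Set.mem_ofPred_eq, hlin] at *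
        nlinarith
      rcases hz with hz | hz
      · left
        rw [hlin]
        nlinarith
      · exact Or.inr (convex_convexHull ℝ _ hy hz hs.le ht.le hst)
  exact (hU hx).resolve_left hlx.not_lt

theorem convexHull_image_eq_setOf_isMax (hl : ∀ i, l (p i) ≤ β)
    (hne : {i | l (p i) = β}.Nonempty) :
    convexHull ℝ (p '' {i | l (p i) = β}) =
      {x ∈ convexHull ℝ (range p) | ∀ y ∈ convexHull ℝ (range p), l y ≤ l x} := by
  obtain ⟨i₀, hi₀⟩ := hne
  ext x
  constructor
  · intro hx
    refine ⟨convexHull_mono (image_subset_range _ _) hx, fun y hy => ?_⟩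
    rw [eq_of_mem_convexHull_image (fun i hi => hi) hx]
    exact le_of_mem_convexHull_range hl hy
  · rintro ⟨hx, hmax⟩
    refine mem_convexHull_image_of_eq hl hx (le_antisymm (le_of_mem_convexHull_range hl hx) ?_)
    have h := hmax _ (subset_convexHull ℝ _ ⟨i₀, rfl⟩)
    exact le_trans (le_of_eq hi₀.symm) h

theorem finite_isExposed_convexHull_range [Finite ι] (p : ι → E) :
    {F | IsExposed ℝ (convexHull ℝ (range p)) F ∧ F.Nonempty}.Finite := by
  refine (Set.finite_range fun S : Set ι => convexHull ℝ (p '' S)).subset ?_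
  rintro F ⟨hF, hne⟩
  obtain ⟨l, hFl⟩ := hF hne
  obtain ⟨x, hx⟩ := hne
  rw [hFl] at hx
  have hl : ∀ i, l (p i) ≤ l x := fun i => hx.2 _ (subset_convexHull ℝ _ ⟨i, rfl⟩)
  refine ⟨_, (convexHull_image_eq_setOf_isMax hl ?_).trans hFl.symm⟩
  have h := mem_convexHull_image_of_eq hl hx.1 rfl
  obtain ⟨_, i, hi, -⟩ := convexHull_nonempty_iff.1 ⟨x, h⟩
  exact ⟨i, hi⟩

end ExposedFaces

section CyclicFaces

open Module

theorem card_faces_cyclicNormal_le {d n m : ℕ} {tau : Fin n → ℝ} (htau : Function.Injective tau)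
    (hn : d + 1 ≤ n) :
    (faces (cyclicNormal d tau) (fun _ => 1) (m + 1)).card ≤
      {F : Set (EuclideanSpace ℝ (Fin d)) |
        IsExposed ℝ (convexHull ℝ (Set.range fun i => momentPt d (tau i))) F ∧
        F.Nonempty ∧ setDim F = m}.ncard := by
  set p : Fin n → EuclideanSpace ℝ (Fin d) := fun i => momentPt d (tau i) with hp
  have hface : ∀ S : Finset (Fin n), IsFace (cyclicNormal d tau) (fun _ => 1) S →
      ∃ l : StrongDual ℝ (EuclideanSpace ℝ (Fin d)), ∃ β, (∀ i, l (p i) ≤ β) ∧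
        {i | l (p i) = β} = S := by
    rintro S ⟨y, hy, hyS⟩
    refine ⟨innerSL ℝ y, 1 + ⟪average p, y⟫, fun i => ?_, ?_⟩
    · have := hy i
      rw [cyclicNormal, inner_sub_left] at this
      rw [innerSL_apply_apply, real_inner_comm]
      linarith
    · ext i
      rw [Finset.mem_coe, ← hyS i, Set.mem_ofPred_eq, innerSL_apply_apply, real_inner_comm,
        cyclicNormal, inner_sub_left, sub_eq_iff_eq_add]
  rw [← Set.ncard_coe_finset]
  refine Set.ncard_le_ncard_of_injOn (fun S => convexHull ℝ (p '' S)) ?_ ?_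
    ((finite_isExposed_convexHull_range p).subset fun F hF => ⟨hF.1, hF.2.1⟩)
  · intro S hS
    rw [Finset.mem_coe, mem_faces] at hS
    obtain ⟨l, β, hl, hlS⟩ := hface S hS.2
    have hne : (S : Set (Fin n)).Nonempty := by
      rw [Finset.coe_nonempty, ← Finset.card_pos, hS.1]
      exact Nat.succ_pos m
    refine ⟨fun _ => ⟨l, ?_⟩, (hne.image p).convexHull, ?_⟩
    · rw [← hlS] at hne ⊢
      exact convexHull_image_eq_setOf_isMax hl hne
    · have hind := (isSimpleSystem_cyclicNormal htau hn).indep S hS.2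
      have haff : AffineIndependent ℝ fun i : S => p i := by
        rw [affineIndependent_iff]
        intro s w hw hs
        refine linearIndependent_iff'.1 hind s w ?_
        simp only [cyclicNormal, smul_sub, Finset.sum_sub_distrib, ← Finset.sum_smul, hw, zero_smul,
          sub_zero]
        exact hs
      rw [setDim, affineSpan_convexHull, direction_affineSpan, Set.image_eq_range]
      exact haff.finrank_vectorSpan (by simpa using hS.1)
  · have key : ∀ S T : Finset (Fin n), IsFace (cyclicNormal d tau) (fun _ => 1) T →
        convexHull ℝ (p '' S) = convexHull ℝ (p '' T) → S ⊆ T := by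
      intro S T hT h i hi
      obtain ⟨l, β, -, hlT⟩ := hface T hT
      have hi' : p i ∈ convexHull ℝ (p '' T) := h ▸ subset_convexHull ℝ _ ⟨i, hi, rfl⟩
      rw [← hlT] at hi'
      rw [← Finset.mem_coe, ← hlT]
      exact eq_of_mem_convexHull_image (fun i hi => hi) hi'
    intro S hS T hT h
    rw [Finset.mem_coe, mem_faces] at hS hT
    exact (key S T hT.2 h).antisymm (key T S hS.2 h.symm)

end CyclicFaces

section Envelope

open Module Submodule

variable {E : Type*} [NormedAddCommGroup E] [InnerProductSpace ℝ E]
variable {ι : Type*} {a : ι → E} {β : ι → ℝ} {S : Finset ι} {y u z : E} {s t T : ℝ}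

/-- The upper envelope of the affine functions `⟪a i, ·⟫ + β i` takes the value `t` at `y`, and the
functions attaining it are exactly those with index in `S`. -/
def Touches (a : ι → E) (β : ι → ℝ) (S : Finset ι) (y : E) (t : ℝ) : Prop :=
  (∀ i, ⟪a i, y⟫ + β i ≤ t) ∧ ∀ i, ⟪a i, y⟫ + β i = t ↔ i ∈ S

theorem Touches.isFace (h : Touches a β S y t) : IsFace a (fun i => t - β i) S :=
  ⟨y, fun i => by linarith [h.1 i], fun i => by rw [← h.2 i, eq_sub_iff_add_eq]⟩

theorem Touches.exists_move [Finite ι] (h : Touches a β S y t) (hS : S.Nonempty)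
    (hu : ∀ i ∈ S, ⟪a i, u⟫ = s) : ∃ ε > 0, Touches a β S (y + ε • u) (t + ε * s) := by
  obtain ⟨o, ho⟩ := hS
  have hoy := (h.2 o).2 ho
  obtain ⟨ε, hε, h1, h2⟩ := exists_pos_move (a := fun i => a i - a o) (b := fun i => β o - β i)
    (T := S) (y := y) (u := u)
    (fun i => by rw [inner_sub_left]; linarith [h.1 i])
    (fun i => by
      rw [inner_sub_left, ← h.2 i]
      constructor <;> intro <;> linarith)
    (fun i hi => by rw [inner_sub_left, hu i hi, hu o ho, sub_self])
  have hot : ⟪a o, y + ε • u⟫ + β o = t + ε * s := by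
    rw [inner_add_right, inner_smul_right, hu o ho]
    linarith
  refine ⟨ε, hε, fun i => ?_, fun i => ?_⟩
  · have := h1 i
    rw [inner_sub_left] at this
    linarith
  · have := h2 i
    rw [inner_sub_left] at this
    rw [show (⟪a i, y + ε • u⟫ + β i = t + ε * s ↔
      ⟪a i, y + ε • u⟫ - ⟪a o, y + ε • u⟫ = β o - β i) by
        constructor <;> intro <;> linarith, this]
    refine ⟨fun hi => hi.1, fun hi => ⟨hi, ?_⟩⟩
    rw [inner_sub_left, hu i hi, hu o ho, sub_self]

theorem Touches.inner_sub_eq (h : Touches a β S y t) (h' : Touches a β S z T) {i : ι}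
    (hi : i ∈ S) : ⟪a i, z - y⟫ = T - t := by
  rw [inner_sub_right]
  linarith [(h.2 i).2 hi, (h'.2 i).2 hi]

/-- If a cell of the upper envelope has a point at which `‖· - w‖² + envelope` exceeds its value at
every vertex, then the envelope takes arbitrarily large values on this cell. -/
theorem Touches.exists_level [Fintype ι] [FiniteDimensional ℝ E]
    (pos : ∀ z ≠ 0, ∃ i, 0 < ⟪a i, z⟫) (w : E) (h : Touches a β S y t) (hS : S.Nonempty)
    (hv : ∀ S' y' t', S ⊆ S' → Touches a β S' y' t' →
      (∀ y'' t'', Touches a β S' y'' t'' → y'' = y') → ‖y' - w‖ ^ 2 + t' < ‖y - w‖ ^ 2 + t)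
    (hT : t < T) : ∃ y', Touches a β S y' T := by
  classical
  obtain ⟨o, ho⟩ := hS
  let F : Set E := {z | (∀ i, ⟪a i, z⟫ + β i ≤ ⟪a o, z⟫ + β o) ∧
    ∀ i ∈ S, ⟪a i, z⟫ + β i = ⟪a o, z⟫ + β o}
  have hyt := (h.2 o).2 ho
  have hyF : y ∈ F :=
    ⟨fun i => by rw [hyt]; exact h.1 i, fun i hi => by rw [hyt]; exact (h.2 i).2 hi⟩
  obtain ⟨z, hz, hzT⟩ : ∃ z ∈ F, T < ⟪a o, z⟫ + β o := by
    by_contra! hbd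
    have hcl : IsClosed F := by
      have h1 : F = (⋂ i, {z | ⟪a i, z⟫ + β i ≤ ⟪a o, z⟫ + β o}) ∩
          ⋂ i ∈ S, {z | ⟪a i, z⟫ + β i = ⟪a o, z⟫ + β o} := by
        ext z
        simp [F]
      rw [h1]
      exact (isClosed_iInter fun i => isClosed_le (by fun_prop) (by fun_prop)).inter
        (isClosed_biInter fun i _ => isClosed_eq (by fun_prop) (by fun_prop))
    have hco : IsCompact F := (isCompact_polyhedron pos fun i => T - β i).of_isClosed_subset hcl
      fun z hz i => by linarith [hz.1 i, hbd z hz]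
    obtain ⟨x, hx, hmax⟩ := hco.exists_isMaxOn ⟨y, hyF⟩
      (f := fun z => ‖z - w‖ ^ 2 + (⟪a o, z⟫ + β o)) (by fun_prop)
    let S' : Finset ι := Finset.univ.filter fun i => ⟪a i, x⟫ + β i = ⟪a o, x⟫ + β o
    have hSS : S ⊆ S' := fun i hi => by simpa [S'] using hx.2 i hi
    have hxS : Touches a β S' x (⟪a o, x⟫ + β o) := ⟨hx.1, fun i => by simp [S']⟩
    have hmem : ∀ y' t', Touches a β S' y' t' → y' ∈ F ∧ ⟪a o, y'⟫ + β o = t' := by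
      intro y' t' h'
      have h0 := (h'.2 o).2 (hSS ho)
      exact ⟨⟨fun i => by rw [h0]; exact h'.1 i,
        fun i hi => by rw [h0]; exact (h'.2 i).2 (hSS hi)⟩, h0⟩
    refine (hv S' x _ hSS hxS ?_).not_ge (by simpa only [Set.mem_ofPred_eq, hyt] using hmax hyF)
    intro y' t' h'
    by_contra hne
    obtain ⟨ε, hε, hm⟩ := hxS.exists_move ⟨o, hSS ho⟩ (u := x - y')
      (s := ⟪a o, x⟫ + β o - t') (fun i hi => h'.inner_sub_eq hxS hi)
    obtain ⟨h1, h2⟩ := hmem _ _ h'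
    obtain ⟨h3, h4⟩ := hmem _ _ hm
    have h5 := hmax h1
    have h6 := hmax h3
    simp only [Set.mem_ofPred_eq] at h5 h6
    rw [h2] at h5
    rw [h4] at h6
    have e1 : y' - w = (x - w) - (x - y') := by abel
    have e2 : x + ε • (x - y') - w = (x - w) + ε • (x - y') := by abel
    rw [e1, norm_sub_sq_real] at h5
    rw [e2, norm_add_sq_real, inner_smul_right, norm_smul, mul_pow, Real.norm_eq_abs, sq_abs] at h6
    have hpos : 0 < ‖x - y'‖ ^ 2 := by
      have : 0 < ‖x - y'‖ := norm_pos_iff.2 (sub_ne_zero.2 (Ne.symm hne))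
      positivity
    nlinarith [mul_le_mul_of_nonneg_left h5 hε.le, mul_pos hε hpos, mul_pos hε (mul_pos hε hpos)]
  set q := ⟪a o, z⟫ + β o
  have hq : 0 < q - t := by linarith
  set l := (T - t) / (q - t)
  have hl0 : 0 < l := div_pos (by linarith) hq
  have hl1 : 0 < 1 - l := by
    rw [sub_pos, div_lt_one hq]
    linarith
  have hlT : (1 - l) * t + l * q = T := by
    have : l * (q - t) = T - t := div_mul_cancel₀ _ hq.ne'
    linarith
  have he : ∀ i, ⟪a i, (1 - l) • y + l • z⟫ + β i =
      (1 - l) * (⟪a i, y⟫ + β i) + l * (⟪a i, z⟫ + β i) := by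
    intro i
    rw [inner_add_right, inner_smul_right, inner_smul_right]
    ring
  refine ⟨(1 - l) • y + l • z, fun i => ?_, fun i => ?_⟩
  · rw [he, ← hlT]
    gcongr
    · exact h.1 i
    · exact hz.1 i
  · rw [he, ← hlT, ← h.2 i]
    constructor
    · intro heq
      refine (h.1 i).antisymm (le_of_mul_le_mul_left ?_ hl1)
      linarith [mul_le_mul_of_nonneg_left (hz.1 i) hl0.le]
    · intro hi
      rw [hi, hz.2 i ((h.2 i).1 hi)]

theorem Touches.finrank_direction_add [Finite ι] [FiniteDimensional ℝ E]
    (h : Touches a β S y t) (h' : Touches a β S z T) (hS : S.Nonempty) (hT : t ≠ T) :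
    finrank ℝ (affineSpan ℝ {x | ∃ t, Touches a β S x t}).direction +
      finrank ℝ (span ℝ (a '' S)) = finrank ℝ E + 1 := by
  obtain ⟨o, ho⟩ := id hS
  have hne : z - y ∉ (span ℝ (a '' S))ᗮ := by
    intro hmem
    have := (mem_orthogonal _ _).1 hmem _ (subset_span ⟨o, ho, rfl⟩)
    rw [h.inner_sub_eq h' ho, sub_eq_zero] at this
    exact hT this.symm
  have horth : ∀ u, (∀ i ∈ S, ⟪a i, u⟫ = 0) → u ∈ (span ℝ (a '' S))ᗮ := by
    intro u hu
    rw [mem_orthogonal']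
    intro v hv
    induction hv using span_induction with
    | mem x hx =>
      obtain ⟨i, hi, rfl⟩ := hx
      rw [real_inner_comm]
      exact hu i hi
    | zero => exact inner_zero_right _
    | add v v' _ _ hv hv' => rw [inner_add_right, hv, hv', add_zero]
    | smul c v _ hv => rw [inner_smul_right, hv, mul_zero]
  have hdir : (affineSpan ℝ {x | ∃ t, Touches a β S x t}).direction =
      (span ℝ (a '' S))ᗮ ⊔ span ℝ {z - y} := by
    rw [direction_affineSpan]
    apply le_antisymm
    · rw [vectorSpan_def, span_le]
      rintro _ ⟨x, ⟨q, hx⟩, x', ⟨q', hx'⟩, rfl⟩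
      refine mem_sup.2 ⟨(x - x') - ((q - q') / (T - t)) • (z - y), horth _ fun i hi => ?_,
        _, smul_mem _ _ (mem_span_singleton_self _), sub_add_cancel _ _⟩
      rw [inner_sub_right, hx'.inner_sub_eq hx hi, inner_smul_right, h.inner_sub_eq h' hi,
        div_mul_cancel₀ _ (sub_ne_zero.2 hT.symm), sub_self]
    · rw [sup_le_iff]
      constructor
      · intro u hu
        obtain ⟨ε, hε, hm⟩ := h.exists_move hS (u := u) (s := 0) fun i hi =>
          (mem_orthogonal _ _).1 hu _ (subset_span ⟨i, hi, rfl⟩)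
        have := vsub_mem_vectorSpan ℝ (s := {x | ∃ t, Touches a β S x t}) ⟨_, hm⟩ ⟨_, h⟩
        rw [vsub_eq_sub, add_sub_cancel_left] at this
        simpa [smul_smul, hε.ne'] using smul_mem _ ε⁻¹ this
      · rw [span_le, Set.singleton_subset_iff]
        exact vsub_mem_vectorSpan ℝ (s := {x | ∃ t, Touches a β S x t}) ⟨_, h'⟩ ⟨_, h⟩
  rw [hdir, finrank_sup_span_singleton hne]
  have := (span ℝ (a '' (S : Set ι))).finrank_add_finrank_orthogonal
  omega

end Envelope

section Voronoi

open Module Submodule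

variable {d : ℕ} {ι : Type*} {p : ι → EuclideanSpace ℝ (Fin d)}

theorem ballPoly_range (p : ι → EuclideanSpace ℝ (Fin d)) (r : ℝ) :
    ballPoly (Set.range p) r = ⋂ i, closedBall (p i) r := by
  simp [ballPoly]

theorem dist_lt_of_mem_interior {x : EuclideanSpace ℝ (Fin d)} {r : ℝ} (hr : r ≠ 0)
    (hx : x ∈ interior (ballPoly (Set.range p) r)) (i : ι) : dist x (p i) < r := by
  rw [ballPoly_range] at hx
  have := interior_mono (Set.iInter_subset _ i) hx
  rwa [interior_closedBall _ hr] at this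

variable [Fintype ι]

theorem dist_sq_eq_norm_sub_average (p : ι → EuclideanSpace ℝ (Fin d)) (i : ι)
    (x : EuclideanSpace ℝ (Fin d)) :
    dist x (p i) ^ 2 = ‖x - average p‖ ^ 2 - ‖average p‖ ^ 2 +
      (⟪(-2 : ℝ) • (p i - average p), x⟫ + ‖p i‖ ^ 2) := by
  rw [dist_eq_norm, norm_sub_sq_real, norm_sub_sq_real, inner_smul_left, inner_sub_left,
    real_inner_comm x, real_inner_comm x]
  simp
  ring

theorem mem_vorF_range_iff (hp : Function.Injective p) {S : Finset ι} (hS : S.Nonempty)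
    {x : EuclideanSpace ℝ (Fin d)} : x ∈ vorF (Set.range p) (p '' S) ↔
      ∃ t, Touches (fun i => (-2 : ℝ) • (p i - average p)) (fun i => ‖p i‖ ^ 2) S x t := by
  have hle : ∀ i j, dist x (p i) ≤ dist x (p j) ↔
      ⟪(-2 : ℝ) • (p i - average p), x⟫ + ‖p i‖ ^ 2 ≤
        ⟪(-2 : ℝ) • (p j - average p), x⟫ + ‖p j‖ ^ 2 := by
    intro i j
    rw [← sq_le_sq₀ dist_nonneg dist_nonneg, dist_sq_eq_norm_sub_average,
      dist_sq_eq_norm_sub_average, add_le_add_iff_left]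
  have hvor : x ∈ vorF (Set.range p) (p '' S) ↔
      ∀ i, i ∈ S ↔ ∀ j, dist x (p j) ≤ dist x (p i) := by
    rw [vorF, Set.mem_ofPred_eq, Set.ext_iff]
    constructor
    · intro h i
      simpa [hp.eq_iff] using h (p i)
    · intro h c
      constructor
      · rintro ⟨i, hi, rfl⟩
        exact ⟨⟨i, rfl⟩, by simpa using (h i).1 hi⟩
      · rintro ⟨⟨i, rfl⟩, hi⟩
        exact ⟨i, (h i).2 (by simpa using hi), rfl⟩
  obtain ⟨o, ho⟩ := hS
  simp only [hvor, hle]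
  constructor
  · intro h
    refine ⟨_, (h o).1 ho, fun i => ⟨fun hi => (h i).2 fun j => ?_, fun hi => ?_⟩⟩
    · rw [hi]
      exact (h o).1 ho j
    · exact ((h o).1 ho i).antisymm ((h i).1 hi o)
  · rintro ⟨t, h1, h2⟩ i
    refine ⟨fun hi j => by rw [(h2 i).2 hi]; exact h1 j, fun hi => (h2 i).1 ((h1 i).antisymm ?_)⟩
    rw [← (h2 o).2 ho]
    exact hi o

theorem Touches.dist_sq {S : Finset ι} {x : EuclideanSpace ℝ (Fin d)} {t : ℝ}
    (h : Touches (fun i => (-2 : ℝ) • (p i - average p)) (fun i => ‖p i‖ ^ 2) S x t) {i : ι}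
    (hi : i ∈ S) : dist x (p i) ^ 2 = ‖x - average p‖ ^ 2 - ‖average p‖ ^ 2 + t := by
  rw [dist_sq_eq_norm_sub_average, (h.2 i).2 hi]

theorem exists_pos_inner_of_setDim_eq [Nonempty ι] (h : setDim (convexHull ℝ (Set.range p)) = d) :
    ∀ z ≠ 0, ∃ i, 0 < ⟪(-2 : ℝ) • (p i - average p), z⟫ := by
  refine pos_of_sum_eq_zero (by rw [← Finset.smul_sum, sum_sub_average, smul_zero]) ?_
  intro z hz
  have hz' : ∀ i, ⟪p i, z⟫ = ⟪average p, z⟫ := by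
    intro i
    have := hz i
    rw [inner_smul_left, inner_sub_left] at this
    simpa [sub_eq_zero] using this
  have htop : vectorSpan ℝ (Set.range p) = ⊤ := by
    rw [setDim, affineSpan_convexHull, direction_affineSpan] at h
    exact eq_top_of_finrank_eq (by rw [h, finrank_euclideanSpace_fin])
  have hle : vectorSpan ℝ (Set.range p) ≤ (span ℝ {z})ᗮ := by
    rw [vectorSpan_def, span_le]
    rintro _ ⟨_, ⟨i, rfl⟩, _, ⟨j, rfl⟩, rfl⟩
    rw [SetLike.mem_coe, mem_orthogonal_singleton_iff_inner_left]
    exact (inner_sub_left _ _ _).trans (by rw [hz', hz', sub_self])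
  have hmem : z ∈ (span ℝ {z})ᗮ := hle (by rw [htop]; exact mem_top)
  rwa [mem_orthogonal_singleton_iff_inner_left, inner_self_eq_zero] at hmem

theorem dist_eq_of_mem_frontier {S : Finset ι} {x : EuclideanSpace ℝ (Fin d)} {t r : ℝ}
    (h : Touches (fun i => (-2 : ℝ) • (p i - average p)) (fun i => ‖p i‖ ^ 2) S x t)
    (hx : x ∈ frontier (ballPoly (Set.range p) r)) {i : ι} (hi : i ∈ S) : dist x (p i) = r := by
  rw [ballPoly_range] at hx
  have hcl : IsClosed (⋂ i, closedBall (p i) r) := isClosed_iInter fun i => isClosed_closedBall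
  refine (Set.mem_iInter.1 (hcl.frontier_subset hx) i).antisymm ?_
  by_contra! hlt
  refine hx.2 (interior_mono (Set.iInter_mono fun j => ball_subset_closedBall)
    ((isOpen_iInter_of_finite fun j => isOpen_ball).interior_eq.ge (Set.mem_iInter.2 fun j => ?_)))
  refine lt_of_le_of_lt ?_ hlt
  rw [← sq_le_sq₀ dist_nonneg dist_nonneg, dist_sq_eq_norm_sub_average, h.dist_sq hi]
  linarith [h.1 j]

theorem fFace_range_le [DecidableEq ι] {a' : ι → EuclideanSpace ℝ (Fin d)} {b' : ι → ℝ} {r : ℝ}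
    {k : ℕ} (hp : Function.Injective p) (hr : 0 < r) (hd : d + 1 ≤ Fintype.card ι)
    (hdim : setDim (convexHull ℝ (Set.range p)) = d)
    (hv : ∀ S ⊆ Set.range p, ∀ v, vorF (Set.range p) S = {v} →
      v ∈ interior (ballPoly (Set.range p) r))
    (hs' : IsSimpleSystem a' b') (hnb : ∀ S : Finset ι, 2 * S.card ≤ d → IsFace a' b' S)
    (hk : 1 ≤ k) (hkd : k ≤ d) : fFace (Set.range p) r k ≤ (faces a' b' (d - k + 1)).card := by
  classical
  have : Nonempty ι := Fintype.card_pos_iff.1 (by omega)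
  set w := average p
  set a : ι → EuclideanSpace ℝ (Fin d) := fun i => (-2 : ℝ) • (p i - w)
  set β : ι → ℝ := fun i => ‖p i‖ ^ 2
  have pos : ∀ z ≠ 0, ∃ i, 0 < ⟪a i, z⟫ := exists_pos_inner_of_setDim_eq hdim
  set T := r ^ 2 + ‖w‖ ^ 2 + 1
  have hfin : finrank ℝ (EuclideanSpace ℝ (Fin d)) = d := finrank_euclideanSpace_fin
  refine le_trans ?_ (card_isFace_le (m := d - k + 1) pos (fun i => T - β i) hs'
    (by rwa [hfin]) (by rwa [hfin]) (by rw [hfin]; omega))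
  refine (Set.ncard_le_ncard ?_ ((Set.toFinite _).image _)).trans
    (Set.ncard_image_le (f := fun S : Finset ι => p '' S) (Set.toFinite _))
  rintro S ⟨hSC, ⟨x, hxS, hx⟩, hSk⟩
  obtain ⟨U, rfl⟩ := Set.subset_range_iff_exists_image_eq.1 hSC
  obtain ⟨S, rfl⟩ : ∃ S : Finset ι, (S : Set ι) = U := ⟨U.toFinset, by simp⟩
  obtain ⟨o, ho⟩ := Finite.exists_max fun i => dist x (p i)
  have hS : S.Nonempty := by
    have : p o ∈ p '' (S : Set ι) := by
      rw [show p '' (S : Set ι) = _ from hxS]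
      exact ⟨⟨o, rfl⟩, by simpa using ho⟩
    obtain ⟨i, hi, -⟩ := this
    exact ⟨i, hi⟩
  obtain ⟨t, ht⟩ : ∃ t, Touches a β S x t := (mem_vorF_range_iff hp hS).1 hxS
  obtain ⟨j, hj⟩ := id hS
  have hxr : r ^ 2 = ‖x - w‖ ^ 2 - ‖w‖ ^ 2 + t := by
    rw [← ht.dist_sq hj, dist_eq_of_mem_frontier ht hx hj]
  have htT : t < T := by nlinarith [sq_nonneg ‖x - w‖]
  obtain ⟨y, hy⟩ := ht.exists_level pos w hS (fun S' y' t' hSS h' huniq => by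
    have hvor : vorF (Set.range p) (p '' S') = {y'} := by
      ext y''
      rw [mem_vorF_range_iff hp (hS.mono hSS), Set.mem_singleton_iff]
      exact ⟨fun ⟨t'', h''⟩ => huniq _ _ h'', fun h => h ▸ ⟨t', h'⟩⟩
    have hlt := dist_lt_of_mem_interior hr.ne' (hv _ (Set.image_subset_range _ _) _ hvor) j
    have := h'.dist_sq (hSS hj)
    have := pow_lt_pow_left₀ hlt dist_nonneg two_ne_zero
    linarith) htT
  refine ⟨S, ⟨hy.isFace, ?_⟩, rfl⟩
  have hrank := ht.finrank_direction_add hy hS htT.ne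
  have hset : {x | ∃ t, Touches a β S x t} = vorF (Set.range p) (p '' S) :=
    Set.ext fun x => (mem_vorF_range_iff hp hS).symm
  rw [hset, hfin] at hrank
  rw [setDim] at hSk
  omega

end Voronoi

/-- the combinatorial upper bound theorem for basic `r`-ball polyhedra:
`f_{k-1}(P_{C,r})` is at most the number of `(d-k)`-dimensional exposed faces of the
cyclic polytope spanned by `n` points of the moment curve. -/
theorem stmt0 {d n : ℕ} (hd : 2 ≤ d) (hn : d + 1 ≤ n)
    (C : Set (EuclideanSpace ℝ (Fin d))) (r : ℝ) (hr : 0 < r)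
    (hC : IsBasicBallPolyhedron C r) (hcard : C.ncard = n)
    (tau : Fin n → ℝ) (htau : StrictMono tau) :
    ∀ k : ℕ, 1 ≤ k → k ≤ d →
      fFace C r k ≤
        {F : Set (EuclideanSpace ℝ (Fin d)) |
          IsExposed ℝ (convexHull ℝ (Set.range fun i => momentPt d (tau i))) F ∧
          F.Nonempty ∧ setDim F = d - k}.ncard := by
  obtain ⟨-, hfin, -, -, hdim, -, -, hv⟩ := hC
  intro k hk hkd
  have := hfin.to_subtype
  let e : Fin n ≃ C := (Finite.equivFinOfCardEq hcard).symm
  have hrange : Set.range (fun i => (e i : EuclideanSpace ℝ (Fin d))) = C := by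
    rw [Set.range_comp' Subtype.val e]
    simp
  rw [← hrange] at hdim hv
  rw [← hrange]
  exact (fFace_range_le (Subtype.val_injective.comp e.injective) hr (by simpa using hn) hdim hv
    (isSimpleSystem_cyclicNormal htau.injective hn)
    (fun S hS => isFace_cyclicNormal htau.injective hn hS) hk hkd).trans
    (card_faces_cyclicNormal_le htau.injective hn)
end

section
/- Let d ≥ 2 and let C be the set of vertices of a d-dimensional convex polytope in E^d with |C| = n ≥ d+1. Then for every nonempty S ⊆ C with V_S ≠ ∅, dim V_S + dim conv(S) = d; that is, V_S is a k-dimensional face of the farthest-point Voronoi diagram of C if and only if conv(S) is a (d−k)-dimensional cell of the farthest-point Delaunay complex of C, for 0 ≤ k ≤ d. -/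
open Metric Set
open scoped RealInnerProductSpace

/-- If `x` and `y` are each equidistant from `a` and `b`, then `y - x` is orthogonal to `b - a`. -/
theorem inner_sub_sub_eq_zero_of_dist_eq {E : Type*} [NormedAddCommGroup E]
    [InnerProductSpace ℝ E] {a b x y : E} (hx : dist x a = dist x b) (hy : dist y a = dist y b) :
    ⟪b - a, y - x⟫ = 0 := by
  rw [dist_comm x, dist_comm x] at hx
  rw [dist_comm y, dist_comm y] at hy
  rw [real_inner_comm]
  exact EuclideanGeometry.inner_vsub_vsub_of_dist_eq_of_dist_eq hx hy

/-- Translating by a vector orthogonal to `b - a` preserves equidistance from `a` and `b`. -/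
theorem dist_add_eq_of_inner_eq_zero {E : Type*} [NormedAddCommGroup E]
    [InnerProductSpace ℝ E] {a b x u : E} (hx : dist x a = dist x b) (hu : ⟪b - a, u⟫ = 0) :
    dist (x + u) a = dist (x + u) b := by
  rw [dist_eq_norm, dist_eq_norm] at hx ⊢
  refine (sq_eq_sq₀ (norm_nonneg _) (norm_nonneg _)).mp ?_
  rw [show x + u - a = (x - a) + u by abel, show x + u - b = (x - b) + u by abel,
    norm_add_sq_real, norm_add_sq_real, hx]
  have h : ⟪x - a, u⟫ - ⟪x - b, u⟫ = ⟪b - a, u⟫ := by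
    rw [← inner_sub_left]
    congr 1
    abel
  linarith

theorem mem_vorF_iff {d : ℕ} {C S : Set (EuclideanSpace ℝ (Fin d))} (hSC : S ⊆ C)
    {s x : EuclideanSpace ℝ (Fin d)} (hs : s ∈ S) :
    x ∈ vorF C S ↔ (∀ c ∈ S, dist x s = dist x c) ∧ ∀ c ∈ C \ S, dist x c < dist x s := by
  constructor
  · intro hx
    have hmem : ∀ c, c ∈ S ↔ c ∈ C ∧ ∀ c' ∈ C, dist x c' ≤ dist x c := fun c =>
      Set.ext_iff.mp hx c
    refine ⟨fun c hc => le_antisymm (((hmem c).mp hc).2 s (hSC hs))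
      (((hmem s).mp hs).2 c (hSC hc)), fun c hc => lt_of_not_ge fun hle => hc.2 ?_⟩
    exact (hmem c).mpr ⟨hc.1, fun c' hc' => (((hmem s).mp hs).2 c' hc').trans hle⟩
  · rintro ⟨heq, hlt⟩
    have hmax : ∀ c ∈ C, dist x c ≤ dist x s := fun c hc => by
      by_cases hcS : c ∈ S
      · exact (heq c hcS).ge
      · exact (hlt c ⟨hc, hcS⟩).le
    refine Set.ext fun c => ⟨fun hc => ⟨hSC hc, fun c' hc' => heq c hc ▸ hmax c' hc'⟩,
      fun hc => ?_⟩
    by_contra hcS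
    exact absurd (hlt c ⟨hc.1, hcS⟩) (not_lt.mpr (hc.2 s (hSC hs)))

/-- The direction of a nonempty Voronoi face is the orthogonal complement of the direction of
its set of farthest points. -/
theorem vectorSpan_vorF {d : ℕ} {C S : Set (EuclideanSpace ℝ (Fin d))} (hfin : C.Finite)
    (hSC : S ⊆ C) (hS : S.Nonempty) (hV : (vorF C S).Nonempty) :
    vectorSpan ℝ (vorF C S) = (vectorSpan ℝ S)ᗮ := by
  obtain ⟨s, hs⟩ := hS
  obtain ⟨x, hx⟩ := hV
  apply le_antisymm
  · rw [vectorSpan_eq_span_vsub_set_right ℝ hx, vectorSpan_eq_span_vsub_set_right ℝ hs,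
      Submodule.span_le]
    rintro _ ⟨y, hy, rfl⟩
    refine (Submodule.mem_orthogonal _ _).mpr fun v hv => ?_
    induction hv using Submodule.span_induction with
    | mem v hv =>
      obtain ⟨c, hc, rfl⟩ := hv
      exact inner_sub_sub_eq_zero_of_dist_eq (((mem_vorF_iff hSC hs).mp hx).1 c hc)
        (((mem_vorF_iff hSC hs).mp hy).1 c hc)
    | zero => exact inner_zero_left _
    | add v w _ _ hv hw => rw [inner_add_left, hv, hw, add_zero]
    | smul r v _ hv => rw [real_inner_smul_left, hv, mul_zero]
  · intro u hu
    have hx' := (mem_vorF_iff hSC hs).mp hx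
    have hnear : ∀ᶠ t : ℝ in nhds 0, ∀ c ∈ C \ S, dist (x + t • u) c < dist (x + t • u) s := by
      refine (Filter.eventually_all_finite hfin.sdiff).mpr fun c hc => ?_
      refine ContinuousAt.eventually_lt (by fun_prop) (by fun_prop) ?_
      simpa using hx'.2 c hc
    obtain ⟨t, ht, ht0⟩ :=
      ((hnear.filter_mono nhdsWithin_le_nhds).and (self_mem_nhdsWithin (s := {0}ᶜ))).exists
    have hmem : x + t • u ∈ vorF C S := by
      refine (mem_vorF_iff hSC hs).mpr
        ⟨fun c hc => dist_add_eq_of_inner_eq_zero (hx'.1 c hc) ?_, ht⟩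
      rw [real_inner_smul_right, (Submodule.mem_orthogonal _ _).mp hu (c - s)
        (vsub_mem_vectorSpan ℝ hc hs), mul_zero]
    have htu : t • u ∈ vectorSpan ℝ (vorF C S) := by
      simpa using vsub_mem_vectorSpan ℝ hmem hx
    exact (Submodule.smul_mem_iff _ ht0).mp htu

/-- for the farthest-point Voronoi diagram of the vertex set of a
`d`-dimensional convex polytope, `dim V_S + dim conv S = d` for every nonempty cell. -/
theorem stmt2 {d n : ℕ} (hd : 2 ≤ d) (hn : d + 1 ≤ n)
    (C : Set (EuclideanSpace ℝ (Fin d))) (hfin : C.Finite) (hcard : C.ncard = n)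
    (hdim : setDim (convexHull ℝ C) = d)
    (hvert : C = Set.extremePoints ℝ (convexHull ℝ C)) :
    ∀ S ⊆ C, S.Nonempty → (vorF C S).Nonempty →
      setDim (vorF C S) + setDim (convexHull ℝ S) = d := by
  intro S hSC hS hV
  rw [setDim, setDim, affineSpan_convexHull, direction_affineSpan, direction_affineSpan,
    vectorSpan_vorF hfin hSC hS hV, add_comm, Submodule.finrank_add_finrank_orthogonal,
    finrank_euclideanSpace_fin]
end

section
/- Let d ≥ 2, let C be the set of vertices of a d-dimensional convex polytope in E^d with |C| = n ≥ d+1, and let r > 0 be such that P_{C,r} is a basic r-ball polyhedron with center-polytope conv(C). Then for every S ⊆ C and every 1 ≤ k ≤ d: V_S ∩ bd(P_{C,r}) ≠ ∅ and dim V_S = k if and only if V_S ≠ ∅, conv(S) ⊆ bd(conv(C)), and dim conv(S) = d − k. (Equivalently: V_S ∩ bd(P_{C,r}) is a (k−1)-dimensional face of P_{C,r} if and only if conv(S) is a (d−k)-dimensional cell of the farthest-point boundary Delaunay complex of C.) -/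
open Metric Set
open scoped RealInnerProductSpace

/-- The squared distance from `x` to `c`, with the summand `‖x‖ ^ 2` removed; it is affine
in `x`. -/
noncomputable def redSqDist {d : ℕ} (x c : EuclideanSpace ℝ (Fin d)) : ℝ :=
  ‖c‖ ^ 2 - 2 * ⟪x, c⟫

/-- The set of farthest points of `C` from `x`. -/
def farSet {d : ℕ} (C : Set (EuclideanSpace ℝ (Fin d))) (x : EuclideanSpace ℝ (Fin d)) :
    Set (EuclideanSpace ℝ (Fin d)) :=
  {c | c ∈ C ∧ ∀ c' ∈ C, redSqDist x c' ≤ redSqDist x c}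

section FarthestPoint

variable {d : ℕ} {C S : Set (EuclideanSpace ℝ (Fin d))} {s x u : EuclideanSpace ℝ (Fin d)}

theorem dist_sq_eq_norm_sq_add_redSqDist (x c : EuclideanSpace ℝ (Fin d)) :
    dist x c ^ 2 = ‖x‖ ^ 2 + redSqDist x c := by
  rw [dist_eq_norm, norm_sub_sq_real, redSqDist]
  ring

theorem dist_le_dist_iff_redSqDist (x c c' : EuclideanSpace ℝ (Fin d)) :
    dist x c' ≤ dist x c ↔ redSqDist x c' ≤ redSqDist x c := by
  rw [← pow_le_pow_iff_left₀ dist_nonneg dist_nonneg two_ne_zero,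
    dist_sq_eq_norm_sq_add_redSqDist, dist_sq_eq_norm_sq_add_redSqDist]
  exact add_le_add_iff_left _

theorem redSqDist_add_smul (x u c : EuclideanSpace ℝ (Fin d)) (t : ℝ) :
    redSqDist (x + t • u) c = redSqDist x c - 2 * t * ⟪u, c⟫ := by
  rw [redSqDist, redSqDist, inner_add_left, real_inner_smul_left]
  ring

theorem continuous_redSqDist (c : EuclideanSpace ℝ (Fin d)) :
    Continuous fun x => redSqDist x c := by
  unfold redSqDist
  fun_prop

theorem mem_vorF_iff_eq_farSet : x ∈ vorF C S ↔ S = farSet C x := by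
  simp only [vorF, farSet, mem_ofPred_eq, dist_le_dist_iff_redSqDist]

theorem nonempty_of_vorF_nonempty (hfin : C.Finite) (hne : C.Nonempty)
    (h : (vorF C S).Nonempty) : S.Nonempty := by
  obtain ⟨x, hx⟩ := h
  rw [mem_vorF_iff_eq_farSet] at hx
  obtain ⟨c, hc, hmax⟩ := Set.exists_max_image C (redSqDist x) hfin hne
  exact ⟨c, hx ▸ ⟨hc, hmax⟩⟩

theorem mem_vorF_iff_of_mem (hSC : S ⊆ C) (hs : s ∈ S) :
    x ∈ vorF C S ↔ (∀ t ∈ S, redSqDist x t = redSqDist x s) ∧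
      ∀ c ∈ C, c ∉ S → redSqDist x c < redSqDist x s := by
  rw [mem_vorF_iff_eq_farSet]
  constructor
  · intro h
    have hs' : s ∈ farSet C x := h ▸ hs
    refine ⟨fun t ht => ?_, fun c hc hcS => ?_⟩
    · have ht' : t ∈ farSet C x := h ▸ ht
      exact le_antisymm (hs'.2 t ht'.1) (ht'.2 s hs'.1)
    · by_contra! hlt
      exact hcS (h ▸ ⟨hc, fun c' hc' => (hs'.2 c' hc').trans hlt⟩)
  · rintro ⟨h1, h2⟩
    have hle : ∀ c ∈ C, redSqDist x c ≤ redSqDist x s := fun c hc => by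
      by_cases hcS : c ∈ S
      · exact (h1 c hcS).le
      · exact (h2 c hc hcS).le
    ext c
    constructor
    · exact fun hc => ⟨hSC hc, fun c' hc' => (hle c' hc').trans (h1 c hc).ge⟩
    · rintro ⟨hc, hmax⟩
      by_contra hcS
      exact absurd (hmax s (hSC hs)) (not_le.2 (h2 c hc hcS))

theorem redSqDist_le_of_mem_vorF (hx : x ∈ vorF C S) (hs : s ∈ S) {c : EuclideanSpace ℝ (Fin d)}
    (hc : c ∈ C) : redSqDist x c ≤ redSqDist x s := by
  rw [mem_vorF_iff_eq_farSet] at hx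
  exact (hx ▸ hs : s ∈ farSet C x).2 c hc

theorem mem_vorF_farSet (C : Set (EuclideanSpace ℝ (Fin d))) (x : EuclideanSpace ℝ (Fin d)) :
    x ∈ vorF C (farSet C x) :=
  mem_vorF_iff_eq_farSet.2 rfl

/-- The faces are relatively open in the set of points equidistant from `S`. -/
theorem eventually_add_smul_mem_vorF (hfin : C.Finite) (hSC : S ⊆ C) (hs : s ∈ S)
    (hx : x ∈ vorF C S) (hu : ∀ t ∈ S, ⟪u, t⟫ = ⟪u, s⟫) :
    ∀ᶠ t : ℝ in nhds 0, x + t • u ∈ vorF C S ∧ x - t • u ∈ vorF C S := by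
  obtain ⟨h1, h2⟩ := (mem_vorF_iff_of_mem hSC hs).1 hx
  have key : ∀ᶠ t : ℝ in nhds 0, x + t • u ∈ vorF C S := by
    have hev : ∀ᶠ t : ℝ in nhds 0, ∀ c ∈ C, c ∉ S →
        redSqDist (x + t • u) c < redSqDist (x + t • u) s := by
      rw [Filter.eventually_all_finite hfin]
      intro c hc
      by_cases hcS : c ∈ S
      · simp [hcS]
      have hc1 : Continuous fun t : ℝ => redSqDist (x + t • u) c :=
        (continuous_redSqDist c).comp (by fun_prop)
      have hc2 : Continuous fun t : ℝ => redSqDist (x + t • u) s :=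
        (continuous_redSqDist s).comp (by fun_prop)
      have := (isOpen_lt hc1 hc2).mem_nhds
        (show (0 : ℝ) ∈ {t : ℝ | redSqDist (x + t • u) c < redSqDist (x + t • u) s} by
          simpa using h2 c hc hcS)
      filter_upwards [this] with t ht _ using ht
    filter_upwards [hev] with t ht
    refine (mem_vorF_iff_of_mem hSC hs).2 ⟨fun t' ht' => ?_, ht⟩
    rw [redSqDist_add_smul, redSqDist_add_smul, h1 t' ht', hu t' ht']
  have hneg : Filter.Tendsto (fun t : ℝ => -t) (nhds 0) (nhds 0) := by
    simpa using (continuous_neg (G := ℝ)).tendsto 0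
  filter_upwards [key, hneg.eventually key] with t ht ht'
  refine ⟨ht, ?_⟩
  simpa [sub_eq_add_neg] using ht'

theorem inner_sub_eq_of_mem_vorF (hSC : S ⊆ C) (hs : s ∈ S) {y : EuclideanSpace ℝ (Fin d)}
    (hx : x ∈ vorF C S) (hy : y ∈ vorF C S) {t : EuclideanSpace ℝ (Fin d)} (ht : t ∈ S) :
    ⟪y - x, t⟫ = ⟪y - x, s⟫ := by
  have h1 := ((mem_vorF_iff_of_mem hSC hs).1 hx).1 t ht
  have h2 := ((mem_vorF_iff_of_mem hSC hs).1 hy).1 t ht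
  simp only [redSqDist] at h1 h2
  rw [inner_sub_left, inner_sub_left]
  linarith

theorem mem_vectorSpan_orthogonal_iff (hs : s ∈ S) :
    u ∈ (vectorSpan ℝ S)ᗮ ↔ ∀ t ∈ S, ⟪u, t⟫ = ⟪u, s⟫ := by
  rw [Submodule.mem_orthogonal', vectorSpan_eq_span_vsub_set_right ℝ hs]
  constructor
  · intro h t ht
    have := h (t - s) (Submodule.subset_span ⟨t, ht, rfl⟩)
    rw [inner_sub_right] at this
    linarith
  · intro h v hv
    induction hv using Submodule.span_induction with
    | mem v hv =>
      obtain ⟨t, ht, rfl⟩ := hv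
      simp [inner_sub_right, h t ht]
    | zero => simp
    | add v w _ _ hv hw => rw [inner_add_right, hv, hw, add_zero]
    | smul a v _ hv => rw [real_inner_smul_right, hv, mul_zero]

theorem vectorSpan_vorF_s3 (hfin : C.Finite) (hSC : S ⊆ C) (hs : s ∈ S)
    (h : (vorF C S).Nonempty) : vectorSpan ℝ (vorF C S) = (vectorSpan ℝ S)ᗮ := by
  obtain ⟨x, hx⟩ := h
  apply le_antisymm
  · rw [vectorSpan_eq_span_vsub_set_right ℝ hx, Submodule.span_le]
    rintro _ ⟨y, hy, rfl⟩
    exact (mem_vectorSpan_orthogonal_iff hs).2 fun t ht => inner_sub_eq_of_mem_vorF hSC hs hx hy ht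
  · intro u hu
    have hev := eventually_add_smul_mem_vorF hfin hSC hs hx
      ((mem_vectorSpan_orthogonal_iff hs).1 hu)
    obtain ⟨t, ht, htpos⟩ := ((hev.filter_mono nhdsWithin_le_nhds).and
      (self_mem_nhdsWithin : Ioi (0 : ℝ) ∈ nhdsWithin 0 (Ioi 0))).exists
    have hmem : (x + t • u) -ᵥ x ∈ vectorSpan ℝ (vorF C S) :=
      vsub_mem_vectorSpan ℝ ht.1 hx
    simp only [vsub_eq_sub, add_sub_cancel_left] at hmem
    exact (Submodule.smul_mem_iff _ (ne_of_gt htpos)).1 hmem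

theorem setDim_vorF_add_setDim_convexHull (hfin : C.Finite) (hne : C.Nonempty) (hSC : S ⊆ C)
    (h : (vorF C S).Nonempty) : setDim (convexHull ℝ S) + setDim (vorF C S) = d := by
  obtain ⟨s, hs⟩ := nonempty_of_vorF_nonempty hfin hne h
  rw [setDim, setDim, affineSpan_convexHull, direction_affineSpan, direction_affineSpan,
    vectorSpan_vorF_s3 hfin hSC hs h, Submodule.finrank_add_finrank_orthogonal,
    finrank_euclideanSpace_fin]

theorem dist_lt_of_mem_interior_ballPoly {r : ℝ} (hr : 0 < r) (hx : x ∈ interior (ballPoly C r))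
    {c : EuclideanSpace ℝ (Fin d)} (hc : c ∈ C) : dist x c < r := by
  have h := interior_mono (biInter_subset_of_mem hc : ballPoly C r ⊆ closedBall c r) hx
  rwa [interior_closedBall _ hr.ne'] at h

theorem mem_interior_ballPoly {r : ℝ} (hfin : C.Finite) (h : ∀ c ∈ C, dist x c < r) :
    x ∈ interior (ballPoly C r) := by
  refine mem_interior.2 ⟨⋂ c ∈ C, ball c r, ?_, hfin.isOpen_biInter fun c _ => isOpen_ball, ?_⟩
  · exact iInter₂_mono fun c _ => ball_subset_closedBall
  · simpa only [mem_iInter₂, mem_ball] using h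

theorem mem_frontier_ballPoly_iff {r : ℝ} (hr : 0 < r) (hfin : C.Finite) (hSC : S ⊆ C) (hs : s ∈ S)
    (hx : x ∈ vorF C S) : x ∈ frontier (ballPoly C r) ↔ dist x s = r := by
  have hle : ∀ c ∈ C, dist x c ≤ dist x s := fun c hc =>
    (dist_le_dist_iff_redSqDist x s c).2 (redSqDist_le_of_mem_vorF hx hs hc)
  have hclosed : IsClosed (ballPoly C r) := isClosed_biInter fun c _ => isClosed_closedBall
  rw [hclosed.frontier_eq]
  constructor
  · rintro ⟨h1, h2⟩
    refine le_antisymm (mem_iInter₂.1 h1 s (hSC hs)) ?_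
    by_contra! hlt
    exact h2 (mem_interior_ballPoly hfin fun c hc => (hle c hc).trans_lt hlt)
  · intro h
    refine ⟨mem_iInter₂.2 fun c hc => (hle c hc).trans h.le, fun h' => ?_⟩
    exact (dist_lt_of_mem_interior_ballPoly hr h' (hSC hs)).ne h

/-- The set of points whose farthest points include all of `S`. -/
def closedVorF (C S : Set (EuclideanSpace ℝ (Fin d))) : Set (EuclideanSpace ℝ (Fin d)) :=
  {x | ∀ c ∈ C, ∀ s ∈ S, redSqDist x c ≤ redSqDist x s}

theorem isClosed_closedVorF : IsClosed (closedVorF C S) := by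
  simp only [closedVorF, ofPred_forall]
  exact isClosed_biInter fun c _ => isClosed_biInter fun s _ =>
    isClosed_le (continuous_redSqDist c) (continuous_redSqDist s)

theorem vorF_subset_closedVorF {T : Set (EuclideanSpace ℝ (Fin d))} (hST : S ⊆ T) :
    vorF C T ⊆ closedVorF C S :=
  fun _ hx _ hc _ hs => redSqDist_le_of_mem_vorF hx (hST hs) hc

theorem subset_farSet_of_mem_closedVorF (hSC : S ⊆ C) (hx : x ∈ closedVorF C S) :
    S ⊆ farSet C x :=
  fun s hs => ⟨hSC hs, fun c hc => hx c hc s hs⟩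

theorem isBounded_closedVorF (hfin : C.Finite)
    (h : ¬ convexHull ℝ S ⊆ frontier (convexHull ℝ C)) (hSC : S ⊆ C) :
    Bornology.IsBounded (closedVorF C S) := by
  obtain ⟨p, hpS, hp⟩ := not_subset.1 h
  have hpC : p ∈ convexHull ℝ C := convexHull_mono hSC hpS
  have hpint : p ∈ interior (convexHull ℝ C) := by
    by_contra hni
    exact hp ⟨subset_closure hpC, hni⟩
  obtain ⟨δ, hδ, hball⟩ := nhds_basis_closedBall.mem_iff.1 (mem_interior_iff_mem_nhds.1 hpint)
  obtain ⟨B, hB⟩ := hfin.isBounded.exists_norm_le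
  obtain ⟨s, hs⟩ := convexHull_nonempty_iff.1 ⟨p, hpS⟩
  refine (isBounded_iff_forall_norm_le).2 ⟨B ^ 2 / (2 * δ), fun z hz => ?_⟩
  rcases eq_or_ne z 0 with rfl | hz0
  · rw [norm_zero]; positivity
  have hzn : 0 < ‖z‖ := norm_pos_iff.2 hz0
  have hupper : convexHull ℝ C ⊆ {q | -(2 * ⟪z, q⟫) ≤ redSqDist z s} := by
    refine convexHull_min (fun c hc => ?_) ?_
    · have := hz c hc s hs
      have h0 := sq_nonneg ‖c‖
      simp only [mem_ofPred_eq]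
      rw [redSqDist] at this
      linarith
    · intro a ha b hb α β hα hβ hαβ
      simp only [mem_ofPred_eq, inner_add_right, real_inner_smul_right] at ha hb ⊢
      calc -(2 * (α * ⟪z, a⟫ + β * ⟪z, b⟫))
          = α * (-(2 * ⟪z, a⟫)) + β * (-(2 * ⟪z, b⟫)) := by ring
        _ ≤ α * redSqDist z s + β * redSqDist z s := by gcongr
        _ = redSqDist z s := by rw [← add_mul, hαβ, one_mul]
  have hlower : convexHull ℝ S ⊆ {q | redSqDist z s - B ^ 2 ≤ -(2 * ⟪z, q⟫)} := by
    refine convexHull_min (fun c hc => ?_) ?_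
    · have := hz s (hSC hs) c hc
      have h0 : ‖c‖ ^ 2 ≤ B ^ 2 := by
        have := hB c (hSC hc)
        gcongr
      simp only [mem_ofPred_eq]
      rw [redSqDist.eq_def z c] at this
      linarith
    · intro a ha b hb α β hα hβ hαβ
      simp only [mem_ofPred_eq, inner_add_right, real_inner_smul_right] at ha hb ⊢
      calc redSqDist z s - B ^ 2
          = α * (redSqDist z s - B ^ 2) + β * (redSqDist z s - B ^ 2) := by
            rw [← add_mul, hαβ, one_mul]
        _ ≤ α * (-(2 * ⟪z, a⟫)) + β * (-(2 * ⟪z, b⟫)) := by gcongr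
        _ = _ := by ring
  have hq : p + (-(δ / ‖z‖)) • z ∈ convexHull ℝ C := by
    apply hball
    rw [mem_closedBall, dist_eq_norm, add_sub_cancel_left, norm_smul, norm_neg, norm_div,
      norm_norm, Real.norm_of_nonneg hδ.le, div_mul_cancel₀ _ hzn.ne']
  have h1 := hupper hq
  have h2 := hlower hpS
  simp only [mem_ofPred_eq, inner_add_right, real_inner_smul_right,
    real_inner_self_eq_norm_sq] at h1 h2
  have h3 : -(δ / ‖z‖) * ‖z‖ ^ 2 = -(δ * ‖z‖) := by field_simp
  rw [h3] at h1
  rw [le_div_iff₀ (by positivity)]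
  linarith

/-- A point of a closed Voronoi cell at maximal distance from its farthest points is a vertex. -/
theorem vorF_farSet_eq_singleton_of_isMaxOn (hfin : C.Finite) (hSC : S ⊆ C) (hs : s ∈ S)
    {z : EuclideanSpace ℝ (Fin d)} (hz : z ∈ closedVorF C S)
    (hmax : IsMaxOn (fun x => dist x s) (closedVorF C S) z) : vorF C (farSet C z) = {z} := by
  have hST := subset_farSet_of_mem_closedVorF hSC hz
  have hTC : farSet C z ⊆ C := fun c hc => hc.1
  refine Subset.antisymm (fun y hy => ?_) (singleton_subset_iff.2 (mem_vorF_farSet C z))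
  have hev := eventually_add_smul_mem_vorF hfin hTC (hST hs) (mem_vorF_farSet C z)
    (u := y - z) fun t ht => inner_sub_eq_of_mem_vorF hTC (hST hs) (mem_vorF_farSet C z) hy ht
  obtain ⟨t, ht, htpos⟩ := ((hev.filter_mono nhdsWithin_le_nhds).and
    (self_mem_nhdsWithin : Ioi (0 : ℝ) ∈ nhdsWithin 0 (Ioi 0))).exists
  have hsq : ∀ w ∈ closedVorF C S, ‖w - s‖ ^ 2 ≤ ‖z - s‖ ^ 2 := fun w hw => by
    have := hmax hw
    simp only [mem_ofPred_eq, dist_eq_norm] at this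
    gcongr
  have h1 := hsq _ (vorF_subset_closedVorF hST ht.1)
  have h2 := hsq _ (vorF_subset_closedVorF hST ht.2)
  have e1 : z + t • (y - z) - s = (z - s) + t • (y - z) := by abel
  have e2 : z - t • (y - z) - s = (z - s) - t • (y - z) := by abel
  rw [e1, norm_add_sq_real] at h1
  rw [e2, norm_sub_sq_real] at h2
  have h3 : ‖t • (y - z)‖ ^ 2 ≤ 0 := by linarith
  have h4 : t • (y - z) = 0 := by
    rw [← norm_eq_zero]
    exact pow_eq_zero_iff two_ne_zero |>.1 (le_antisymm h3 (sq_nonneg _))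
  rcases smul_eq_zero.1 h4 with h5 | h5
  · exact absurd h5 (ne_of_gt htpos)
  · exact sub_eq_zero.1 h5

/-- Moving from a point of a face in a direction orthogonal to `S`, along which some point of `C`
catches up, reaches a point with strictly more farthest points. -/
theorem exists_ssubset_farSet (hfin : C.Finite) (hSC : S ⊆ C) (hs : s ∈ S) (hx : x ∈ vorF C S)
    (hu : ∀ t ∈ S, ⟪u, t⟫ = ⟪u, s⟫) {c : EuclideanSpace ℝ (Fin d)} (hc : c ∈ C)
    (hlt : ⟪u, c⟫ < ⟪u, s⟫) : ∃ z, S ⊂ farSet C z := by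
  obtain ⟨h1, -⟩ := (mem_vorF_iff_of_mem hSC hs).1 hx
  let τ : EuclideanSpace ℝ (Fin d) → ℝ := fun c =>
    (redSqDist x s - redSqDist x c) / (2 * (⟪u, s⟫ - ⟪u, c⟫))
  obtain ⟨a, ⟨haC, hau⟩, hamin⟩ := Set.exists_min_image {c ∈ C | ⟪u, c⟫ < ⟪u, s⟫} τ
    (hfin.subset (sep_subset C _)) ⟨c, hc, hlt⟩
  have hτ0 : 0 ≤ τ a :=
    div_nonneg (sub_nonneg.2 (redSqDist_le_of_mem_vorF hx hs haC)) (by linarith)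
  have hle : ∀ c' ∈ C, redSqDist (x + τ a • u) c' ≤ redSqDist (x + τ a • u) s := by
    intro c' hc'
    rw [redSqDist_add_smul, redSqDist_add_smul]
    have hxc := redSqDist_le_of_mem_vorF hx hs hc'
    by_cases hlt' : ⟪u, c'⟫ < ⟪u, s⟫
    · have hm : τ a ≤ τ c' := hamin c' ⟨hc', hlt'⟩
      rw [le_div_iff₀ (by linarith)] at hm
      linarith
    · have : τ a * ⟪u, s⟫ ≤ τ a * ⟪u, c'⟫ := mul_le_mul_of_nonneg_left (not_lt.1 hlt') hτ0
      linarith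
  have haeq : redSqDist (x + τ a • u) a = redSqDist (x + τ a • u) s := by
    rw [redSqDist_add_smul, redSqDist_add_smul]
    have hτa : τ a * (2 * (⟪u, s⟫ - ⟪u, a⟫)) = redSqDist x s - redSqDist x a :=
      div_mul_cancel₀ _ (by linarith)
    linarith
  have hsub : S ⊆ farSet C (x + τ a • u) := fun t ht => by
    refine ⟨hSC ht, fun c' hc' => ?_⟩
    rw [redSqDist_add_smul x u t, h1 t ht, hu t ht, ← redSqDist_add_smul]
    exact hle c' hc'
  have haF : a ∈ farSet C (x + τ a • u) := ⟨haC, fun c' hc' => (hle c' hc').trans haeq.ge⟩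
  exact ⟨x + τ a • u, hsub, fun h => hau.ne (hu a (h haF))⟩

theorem exists_vertex_superset (hfin : C.Finite) (hspan : vectorSpan ℝ C = ⊤) (hne : C.Nonempty)
    (hSC : S ⊆ C) (h : (vorF C S).Nonempty) : ∃ T ⊆ C, S ⊆ T ∧ ∃ v, vorF C T = {v} := by
  have hF : {T | T ⊆ C ∧ S ⊆ T ∧ (vorF C T).Nonempty}.Finite :=
    hfin.finite_subsets.subset fun T hT => hT.1
  obtain ⟨T, ⟨hTC, hST, x, hx⟩, hTmax⟩ := hF.exists_maximal ⟨S, hSC, Subset.rfl, h⟩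
  refine ⟨T, hTC, hST, x, Subset.antisymm (fun y hy => ?_) (singleton_subset_iff.2 hx)⟩
  obtain ⟨s, hs⟩ := nonempty_of_vorF_nonempty hfin hne ⟨x, hx⟩
  have hno : ∀ z, ¬ T ⊂ farSet C z := fun z hz =>
    hz.2 (hTmax ⟨fun c hc => hc.1, hST.trans hz.1, z, mem_vorF_farSet C z⟩ hz.1)
  have hu : ∀ t ∈ T, ⟪y - x, t⟫ = ⟪y - x, s⟫ := fun t ht =>
    inner_sub_eq_of_mem_vorF hTC hs hx hy ht
  have hC : ∀ c ∈ C, ⟪y - x, c⟫ = ⟪y - x, s⟫ := by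
    intro c hc
    by_contra hcs
    rcases lt_or_gt_of_ne hcs with hlt | hlt
    · obtain ⟨z, hz⟩ := exists_ssubset_farSet hfin hTC hs hx hu hc hlt
      exact hno z hz
    · obtain ⟨z, hz⟩ := exists_ssubset_farSet hfin hTC hs hx (u := -(y - x))
        (fun t ht => by rw [inner_neg_left, inner_neg_left, hu t ht]) hc
        (by rw [inner_neg_left, inner_neg_left]; linarith)
      exact hno z hz
  have hmem := (mem_vectorSpan_orthogonal_iff (hTC hs)).2 hC
  rw [hspan, Submodule.top_orthogonal_eq_bot, Submodule.mem_bot] at hmem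
  exact sub_eq_zero.1 hmem

theorem redSqDist_combo (x y c : EuclideanSpace ℝ (Fin d)) {a b : ℝ} (hab : a + b = 1) :
    redSqDist (a • x + b • y) c = a * redSqDist x c + b * redSqDist y c := by
  simp only [redSqDist, inner_add_left, real_inner_smul_left]
  linear_combination (-‖c‖ ^ 2) * hab

theorem combo_mem_vorF (hSC : S ⊆ C) (hs : s ∈ S) {y : EuclideanSpace ℝ (Fin d)}
    (hx : x ∈ vorF C S) (hy : y ∈ closedVorF C S) {a b : ℝ} (ha : 0 < a) (hb : 0 ≤ b)
    (hab : a + b = 1) : a • x + b • y ∈ vorF C S := by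
  obtain ⟨h1, h2⟩ := (mem_vorF_iff_of_mem hSC hs).1 hx
  refine (mem_vorF_iff_of_mem hSC hs).2 ⟨fun t ht => ?_, fun c hc hcS => ?_⟩
  · rw [redSqDist_combo _ _ _ hab, redSqDist_combo _ _ _ hab, h1 t ht,
      le_antisymm (hy t (hSC ht) s hs) (hy s (hSC hs) t ht)]
  · rw [redSqDist_combo _ _ _ hab, redSqDist_combo _ _ _ hab]
    exact add_lt_add_of_lt_of_le (mul_lt_mul_of_pos_left (h2 c hc hcS) ha)
      (mul_le_mul_of_nonneg_left (hy c hc s hs) hb)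

theorem convex_vorF (hSC : S ⊆ C) (hs : s ∈ S) : Convex ℝ (vorF C S) :=
  convex_iff_forall_pos.2 fun _ hx _ hy _ _ ha hb hab =>
    combo_mem_vorF hSC hs hx (vorF_subset_closedVorF Subset.rfl hy) ha hb.le hab

/-- If `conv S` lies on the boundary of `conv C`, then the face of `S` is unbounded. -/
theorem exists_mem_vorF_lt_dist (hspan : vectorSpan ℝ C = ⊤) (hne : C.Nonempty)
    (hSC : S ⊆ C) (hs : s ∈ S) (hx : x ∈ vorF C S)
    (h : convexHull ℝ S ⊆ frontier (convexHull ℝ C)) (r : ℝ) :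
    ∃ y ∈ vorF C S, r < dist y s := by
  have hinterior : (interior (convexHull ℝ C)).Nonempty := by
    rw [interior_convexHull_nonempty_iff_affineSpan_eq_top]
    exact (AffineSubspace.affineSpan_eq_top_iff_vectorSpan_eq_top_of_nonempty ℝ _ _ hne).2 hspan
  have hdisj : Disjoint (interior (convexHull ℝ C)) (convexHull ℝ S) :=
    Set.disjoint_left.2 fun a ha ha' => (h ha').2 ha
  obtain ⟨f, m, hfC, hfS⟩ := geometric_hahn_banach_open (convex_convexHull ℝ C).interior
    isOpen_interior (convex_convexHull ℝ S) hdisj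
  have hfle : ∀ c ∈ C, f c ≤ m := by
    intro c hc
    have hcl : c ∈ closure (interior (convexHull ℝ C)) := by
      rw [(convex_convexHull ℝ C).closure_interior_eq_closure_of_nonempty_interior hinterior]
      exact subset_closure (subset_convexHull ℝ C hc)
    exact closure_minimal (fun a ha => (hfC a ha).le) (isClosed_le f.continuous continuous_const)
      hcl
  have hfeq : ∀ t ∈ S, f t = m := fun t ht =>
    le_antisymm (hfle t (hSC ht)) (hfS t (subset_convexHull ℝ S ht))
  obtain ⟨w, rfl⟩ : ∃ w, innerSL ℝ w = f :=
    (InnerProductSpace.toDual ℝ _).surjective f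
  simp only [innerSL_apply_apply] at hfC hfle hfeq
  have hw : w ≠ 0 := by
    rintro rfl
    obtain ⟨a, ha⟩ := hinterior
    have h1 := hfC a ha
    have h2 := hfeq s hs
    rw [inner_zero_left] at h1 h2
    linarith
  obtain ⟨h1, h2⟩ := (mem_vorF_iff_of_mem hSC hs).1 hx
  have hwn : 0 < ‖w‖ := norm_pos_iff.2 hw
  obtain ⟨t, ht0, ht⟩ : ∃ t : ℝ, 0 ≤ t ∧ r + dist x s < t * ‖w‖ := by
    refine ⟨(|r + dist x s| + 1) / ‖w‖, by positivity, ?_⟩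
    rw [div_mul_cancel₀ _ hwn.ne']
    linarith [le_abs_self (r + dist x s)]
  refine ⟨x + (-t) • w, (mem_vorF_iff_of_mem hSC hs).2 ⟨fun t' ht' => ?_, fun c hc hcS => ?_⟩, ?_⟩
  · rw [redSqDist_add_smul, redSqDist_add_smul, h1 t' ht', hfeq t' ht', hfeq s hs]
  · rw [redSqDist_add_smul, redSqDist_add_smul, hfeq s hs]
    have := mul_le_mul_of_nonneg_left (hfle c hc) ht0
    linarith [h2 c hc hcS]
  · have htri := dist_triangle (x + (-t) • w) s x
    have hd : dist (x + (-t) • w) x = t * ‖w‖ := by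
      rw [dist_eq_norm, add_sub_cancel_left, norm_smul, norm_neg, Real.norm_of_nonneg ht0]
    rw [hd, dist_comm s x] at htri
    linarith

theorem frontier_inter_nonempty_iff {r : ℝ} (hr : 0 < r) (hfin : C.Finite)
    (hspan : vectorSpan ℝ C = ⊤) (hne : C.Nonempty) (hSC : S ⊆ C) (h : (vorF C S).Nonempty)
    (hvert : ∀ T ⊆ C, ∀ v, vorF C T = {v} → v ∈ interior (ballPoly C r)) :
    (vorF C S ∩ frontier (ballPoly C r)).Nonempty ↔
      convexHull ℝ S ⊆ frontier (convexHull ℝ C) := by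
  obtain ⟨s, hs⟩ := nonempty_of_vorF_nonempty hfin hne h
  constructor
  · rintro ⟨x, hx, hxf⟩
    rw [mem_frontier_ballPoly_iff hr hfin hSC hs hx] at hxf
    by_contra hb
    have hxK : x ∈ closedVorF C S := vorF_subset_closedVorF Subset.rfl hx
    obtain ⟨z, hz, hmax⟩ := (isCompact_of_isClosed_isBounded isClosed_closedVorF
      (isBounded_closedVorF hfin hb hSC)).exists_isMaxOn ⟨x, hxK⟩
      (f := fun x => dist x s) (by fun_prop)
    have hlt := dist_lt_of_mem_interior_ballPoly hr (hvert _ (fun c hc => hc.1) z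
      (vorF_farSet_eq_singleton_of_isMaxOn hfin hSC hs hz hmax)) (hSC hs)
    have hle : dist x s ≤ dist z s := hmax hxK
    linarith
  · intro hb
    obtain ⟨x, hx⟩ := h
    obtain ⟨T, hTC, hST, v, hv⟩ := exists_vertex_superset hfin hspan hne hSC ⟨x, hx⟩
    have hvK : v ∈ closedVorF C S := vorF_subset_closedVorF hST (hv ▸ mem_singleton v)
    have hvr : dist v s < r := dist_lt_of_mem_interior_ballPoly hr (hvert T hTC v hv) (hSC hs)
    obtain ⟨y, hy, hyr⟩ := exists_mem_vorF_lt_dist hspan hne hSC hs hx hb r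
    obtain ⟨z, hz, hzr⟩ : ∃ z ∈ vorF C S, dist z s < r := by
      have hcont : Continuous fun a : ℝ => dist (a • x + (1 - a) • v) s := by fun_prop
      have hev : ∀ᶠ a : ℝ in nhds 0, dist (a • x + (1 - a) • v) s < r :=
        hcont.continuousAt.eventually_lt continuousAt_const (by simpa using hvr)
      obtain ⟨a, ha, ha0, ha1⟩ := ((hev.filter_mono nhdsWithin_le_nhds).and
        (Ioo_mem_nhdsGT (zero_lt_one : (0 : ℝ) < 1))).exists
      exact ⟨_, combo_mem_vorF hSC hs hx hvK ha0 (by linarith) (by ring), ha⟩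
    obtain ⟨p, hp, hpr⟩ := (convex_vorF hSC hs).isPreconnected.intermediate_value hz hy
      (f := fun x => dist x s) (by fun_prop) ⟨hzr.le, hyr.le⟩
    exact ⟨p, hp, (mem_frontier_ballPoly_iff hr hfin hSC hs hp).2 hpr⟩

end FarthestPoint


/-- `V_S ∩ bd(P_{C,r})` is a `(k-1)`-dimensional face of `P_{C,r}` iff `conv S`
is a `(d-k)`-dimensional cell of the farthest-point boundary Delaunay complex of `C`. -/
theorem stmt3 {d n : ℕ} (hd : 2 ≤ d) (hn : d + 1 ≤ n)
    (C : Set (EuclideanSpace ℝ (Fin d))) (hcard : C.ncard = n) (r : ℝ) (hr : 0 < r)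
    (hC : IsBasicBallPolyhedron C r) :
    ∀ S ⊆ C, ∀ k : ℕ, 1 ≤ k → k ≤ d →
      (((vorF C S ∩ frontier (ballPoly C r)).Nonempty ∧ setDim (vorF C S) = k) ↔
        ((vorF C S).Nonempty ∧ convexHull ℝ S ⊆ frontier (convexHull ℝ C) ∧
          setDim (convexHull ℝ S) = d - k)) := by
  obtain ⟨-, hfin, hcard', -, hdim, -, -, hvert⟩ := hC
  have hne : C.Nonempty := nonempty_of_ncard_ne_zero (by omega)
  have hspan : vectorSpan ℝ C = ⊤ := by
    rw [setDim, affineSpan_convexHull, direction_affineSpan] at hdim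
    exact Submodule.eq_top_of_finrank_eq (hdim.trans finrank_euclideanSpace_fin.symm)
  intro S hSC k hk hkd
  have hdims : (vorF C S).Nonempty →
      (setDim (vorF C S) = k ↔ setDim (convexHull ℝ S) = d - k) := fun h => by
    have := setDim_vorF_add_setDim_convexHull hfin hne hSC h
    omega
  constructor
  · rintro ⟨h, hk'⟩
    have hV := h.mono inter_subset_left
    exact ⟨hV, (frontier_inter_nonempty_iff hr hfin hspan hne hSC hV hvert).1 h,
      (hdims hV).1 hk'⟩
  · rintro ⟨hV, hb, hk'⟩
    exact ⟨(frontier_inter_nonempty_iff hr hfin hspan hne hSC hV hvert).2 hb, (hdims hV).2 hk'⟩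
end

section
/- Let l ≥ 0, let p* ∈ E^{l+1}, and let Q ⊆ E^{l+1} be an unbounded closed convex polyhedral set (a finite intersection of closed half-spaces) with nonempty interior whose recession cone rec(Q) is pointed and (l+1)-dimensional. Then there exists s₀ > 0 with the following property: for every s* ≥ s₀, all extreme points of Q are contained in the open ball B(p*, s*), and the intersection sphere(p*, s*) ∩ Q is homeomorphic to a closed l-dimensional Euclidean ball. -/
open Metric Set
open scoped RealInnerProductSpace

/-- The recession cone of a set `A`. -/
def recCone {m : ℕ} (A : Set (EuclideanSpace ℝ (Fin m))) : Set (EuclideanSpace ℝ (Fin m)) :=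
  {y | ∀ x ∈ A, ∀ l : ℝ, 0 ≤ l → x + l • y ∈ A}

/-- A polyhedron has finitely many extreme points. -/
theorem finite_extremePoints_iInter_halfSpace {E ι : Type*} [NormedAddCommGroup E]
    [InnerProductSpace ℝ E] [Finite ι] (a : ι → E) (b : ι → ℝ) :
    (Set.extremePoints ℝ (⋂ i, {x : E | ⟪a i, x⟫ ≤ b i})).Finite := by
  refine Set.Finite.of_finite_image (f := fun x => {i | ⟪a i, x⟫ = b i}) (Set.toFinite _) ?_
  intro x hx y hy hxy
  rw [mem_extremePoints] at hx hy
  have hxQ : ∀ i, ⟪a i, x⟫ ≤ b i := by simpa using hx.1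
  have hev : ∀ᶠ ε : ℝ in nhdsWithin 0 (Ioi 0),
      ∀ i, ⟪a i, x + ε • (y - x)⟫ ≤ b i ∧ ⟪a i, x - ε • (y - x)⟫ ≤ b i := by
    rw [Filter.eventually_all]
    intro i
    rcases (hxQ i).lt_or_eq with h | h
    · have h₁ : ContinuousAt (fun ε : ℝ => ⟪a i, x + ε • (y - x)⟫) 0 := by fun_prop
      have h₂ : ContinuousAt (fun ε : ℝ => ⟪a i, x - ε • (y - x)⟫) 0 := by fun_prop
      have e₁ := h₁.eventually_lt (continuousAt_const (y := b i)) (by simpa using h)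
      have e₂ := h₂.eventually_lt (continuousAt_const (y := b i)) (by simpa using h)
      exact nhdsWithin_le_nhds ((e₁.and e₂).mono fun ε hε => ⟨hε.1.le, hε.2.le⟩)
    · have hy' : ⟪a i, y⟫ = b i := (Set.ext_iff.1 hxy i).1 h
      refine Filter.Eventually.of_forall fun ε => ?_
      simp [inner_add_right, inner_sub_right, inner_smul_right, h, hy']
  obtain ⟨ε, hε, hpos⟩ := (hev.and self_mem_nhdsWithin).exists
  have hmem : x ∈ openSegment ℝ (x + ε • (y - x)) (x - ε • (y - x)) :=
    ⟨1 / 2, 1 / 2, by norm_num, by norm_num, by norm_num, by module⟩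
  have := (hx.2 _ (by simpa using fun i => (hε i).1) _ (by simpa using fun i => (hε i).2) hmem).1
  have h0 : ε • (y - x) = 0 := by simpa using this
  rcases smul_eq_zero.1 h0 with h | h
  · exact absurd h (ne_of_gt hpos)
  · exact (sub_eq_zero.1 h).symm

section Stereographic

variable {E : Type*} [NormedAddCommGroup E] [InnerProductSpace ℝ E] {v : E}

/-- In stereographic coordinates, a spherical cap is the solution set of a quadratic inequality. -/
theorem inner_stereoInvFun_le_iff (hv : ‖v‖ = 1) (a : E) (β : ℝ) (w : (ℝ ∙ v)ᗮ) :
    ⟪a, (stereoInvFun hv w : E)⟫ ≤ β ↔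
      (⟪a, v⟫ - β) * ‖w‖ ^ 2 + 4 * ⟪a, (w : E)⟫ ≤ 4 * (⟪a, v⟫ + β) := by
  have h : 0 < ‖w‖ ^ 2 + 4 := by positivity
  rw [stereoInvFun_apply, inner_smul_right, inner_add_right, inner_smul_right, inner_smul_right,
    inv_mul_le_iff₀ h]
  constructor <;> intro h <;> linarith

/-- A spherical cap missing the pole of the stereographic projection has convex image. -/
theorem convex_stereoInvFun_preimage (hv : ‖v‖ = 1) {a : E} {β : ℝ} (h : β < ⟪a, v⟫) :
    Convex ℝ {w : (ℝ ∙ v)ᗮ | ⟪a, (stereoInvFun hv w : E)⟫ ≤ β} := by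
  simp_rw [inner_stereoInvFun_le_iff]
  have h₁ : ConvexOn ℝ univ fun w : (ℝ ∙ v)ᗮ => (⟪a, v⟫ - β) * ‖w‖ ^ 2 := by
    have := ((convexOn_norm (convex_univ (𝕜 := ℝ) (E := (ℝ ∙ v)ᗮ))).pow
      (fun _ _ => norm_nonneg _) 2).smul (sub_pos.2 h).le
    simpa using this
  have h₂ : ConvexOn ℝ univ fun w : (ℝ ∙ v)ᗮ => 4 * ⟪a, (w : E)⟫ :=
    (((4 : ℝ) • (innerₛₗ ℝ a)).comp (ℝ ∙ v)ᗮ.subtype).convexOn convex_univ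
  simpa using (h₁.add h₂).convex_le (4 * (⟪a, v⟫ + β))

/-- A spherical cap missing the pole of the stereographic projection has bounded image. -/
theorem isBounded_stereoInvFun_preimage (hv : ‖v‖ = 1) {a : E} {β : ℝ} (h : β < ⟪a, v⟫) :
    Bornology.IsBounded {w : (ℝ ∙ v)ᗮ | ⟪a, (stereoInvFun hv w : E)⟫ ≤ β} := by
  simp_rw [inner_stereoInvFun_le_iff]
  have hc := sub_pos.2 h
  set c := ⟪a, v⟫ - β
  refine isBounded_iff_forall_norm_le.2
    ⟨(4 * ‖a‖ + 4 * |⟪a, v⟫ + β|) / c + 1, fun w hw => ?_⟩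
  rw [mem_ofPred_eq] at hw
  by_contra! hlt
  have hdiv : 0 ≤ (4 * ‖a‖ + 4 * |⟪a, v⟫ + β|) / c := by positivity
  have h1 : 1 < ‖w‖ := by linarith
  have h2 : 4 * ‖a‖ + 4 * |⟪a, v⟫ + β| < c * ‖w‖ := by
    rw [← div_lt_iff₀' hc]
    linarith
  have h3 : -(‖a‖ * ‖w‖) ≤ ⟪a, (w : E)⟫ :=
    (abs_le.1 (abs_real_inner_le_norm a (w : E))).1
  nlinarith [le_abs_self (⟪a, v⟫ + β), abs_nonneg (⟪a, v⟫ + β)]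

/-- A finite nonempty family of spherical caps which all miss a point of the sphere and contain the
antipode of that point in their interior intersects in a topological ball. -/
theorem nonempty_homeomorph_closedBall_of_caps [FiniteDimensional ℝ E] {n : ℕ}
    (hn : Module.finrank ℝ E = n + 1) {ι : Type*} [Finite ι] [Nonempty ι] (hv : ‖v‖ = 1)
    {a : ι → E} {β : ι → ℝ} (hpole : ∀ i, β i < ⟪a i, v⟫) (hanti : ∀ i, -⟪a i, v⟫ < β i) :
    Nonempty ({z : E | ‖z‖ = 1 ∧ ∀ i, ⟪a i, z⟫ ≤ β i} ≃ₜ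
      closedBall (0 : EuclideanSpace ℝ (Fin n)) 1) := by
  set D : Set (ℝ ∙ v)ᗮ := ⋂ i, {w | ⟪a i, (stereoInvFun hv w : E)⟫ ≤ β i} with hD
  have hcont : Continuous fun w : (ℝ ∙ v)ᗮ => (stereoInvFun hv w : E) :=
    continuous_subtype_val.comp (continuous_stereoInvFun hv)
  have hconv : Convex ℝ D := convex_iInter fun i => convex_stereoInvFun_preimage hv (hpole i)
  have hclosed : IsClosed D :=
    isClosed_iInter fun i => isClosed_le (continuous_const.inner hcont) continuous_const
  have hbdd : Bornology.IsBounded D :=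
    (isBounded_stereoInvFun_preimage hv (hpole (Classical.arbitrary ι))).subset
      (iInter_subset _ _)
  have hne : (interior D).Nonempty := by
    refine ⟨0, mem_interior_iff_mem_nhds.2 ?_⟩
    rw [hD, Filter.iInter_mem]
    intro i
    have h0 : ⟪a i, (stereoInvFun hv 0 : E)⟫ < β i := by
      rw [stereoInvFun_apply]
      have : ((‖(0 : (ℝ ∙ v)ᗮ)‖ ^ 2 + 4)⁻¹ : ℝ) •
          ((4 : ℝ) • ((0 : (ℝ ∙ v)ᗮ) : E) + (‖(0 : (ℝ ∙ v)ᗮ)‖ ^ 2 - 4) • v) = -v := by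
        simp
      rw [this, inner_neg_right]
      exact hanti i
    exact ((continuous_const.inner hcont).continuousAt.eventually_lt
      continuousAt_const h0).mono fun _ h => h.le
  have : CompactSpace D := isCompact_iff_compactSpace.1
    (Metric.isCompact_of_isClosed_isBounded hclosed hbdd)
  let g : D → {z : E | ‖z‖ = 1 ∧ ∀ i, ⟪a i, z⟫ ≤ β i} := fun w =>
    ⟨stereoInvFun hv w, by simpa using (stereoInvFun hv (w : (ℝ ∙ v)ᗮ)).2, mem_iInter.1 w.2⟩
  have hg : Function.Bijective g := by
    constructor
    · intro w w' h
      have h' : (stereoInvFun hv w : E) = stereoInvFun hv w' := by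
        simpa [g] using congrArg Subtype.val h
      apply Subtype.ext
      rw [← stereo_right_inv hv w, ← stereo_right_inv hv w', h']
    · rintro ⟨z, hz, hza⟩
      have hzv : z ≠ v := by
        rintro rfl
        exact (hza (Classical.arbitrary ι)).not_gt (hpole _)
      have hinv := congrArg Subtype.val
        (stereo_left_inv hv (x := ⟨z, by simpa using hz⟩) hzv)
      refine ⟨⟨stereoToFun v z, mem_iInter.2 fun i => ?_⟩, Subtype.ext hinv⟩
      have := hza i
      rw [mem_ofPred_eq, hinv]
      exact this
  have hgc : Continuous (Equiv.ofBijective g hg) :=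
    (hcont.comp continuous_subtype_val).subtype_mk _
  have e₁ := hgc.homeoOfEquivCompactToT2
  obtain ⟨h, -, hh, -⟩ :=
    exists_homeomorph_image_interior_closure_frontier_eq_unitBall hconv hne hbdd
  rw [hclosed.closure_eq] at hh
  have : Fact (Module.finrank ℝ E = n + 1) := ⟨hn⟩
  let b := OrthonormalBasis.fromOrthogonalSpanSingleton (𝕜 := ℝ) n
    (show v ≠ 0 from fun h => by simp [h] at hv)
  have e₂ : D ≃ₜ closedBall (0 : (ℝ ∙ v)ᗮ) 1 := (h.image D).trans (.setCongr hh)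
  have e₃ : closedBall (0 : (ℝ ∙ v)ᗮ) 1 ≃ₜ closedBall (0 : EuclideanSpace ℝ (Fin n)) 1 :=
    (b.repr.toHomeomorph.image _).trans (.setCongr (by simp))
  exact ⟨e₁.symm.trans (e₂.trans e₃)⟩

end Stereographic

/-- A vector of the recession cone of a polyhedron satisfies the homogeneous inequalities. -/
theorem inner_nonpos_of_mem_recCone {m : ℕ} {ι : Type*} {a : ι → EuclideanSpace ℝ (Fin m)}
    {b : ι → ℝ} (hne : (⋂ i, {x | ⟪a i, x⟫ ≤ b i}).Nonempty) {y : EuclideanSpace ℝ (Fin m)}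
    (hy : y ∈ recCone (⋂ i, {x | ⟪a i, x⟫ ≤ b i})) (i : ι) : ⟪a i, y⟫ ≤ 0 := by
  obtain ⟨x, hx⟩ := hne
  by_contra! hpos
  have hxi : ⟪a i, x⟫ ≤ b i := mem_iInter.1 hx i
  have hle : 0 ≤ (b i - ⟪a i, x⟫ + 1) / ⟪a i, y⟫ := by
    have : 0 ≤ b i - ⟪a i, x⟫ + 1 := by linarith
    positivity
  have h : ⟪a i, x + ((b i - ⟪a i, x⟫ + 1) / ⟪a i, y⟫) • y⟫ ≤ b i :=
    mem_iInter.1 (hy x hx _ hle) i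
  rw [inner_add_right, inner_smul_right, div_mul_cancel₀ _ hpos.ne'] at h
  linarith

/-- If the recession cone of a polyhedron spans, some vector strictly satisfies all homogeneous
inequalities. -/
theorem exists_forall_inner_neg {m : ℕ} {ι : Type*} [Finite ι]
    {a : ι → EuclideanSpace ℝ (Fin m)} {b : ι → ℝ} (ha : ∀ i, a i ≠ 0)
    (hne : (⋂ i, {x | ⟪a i, x⟫ ≤ b i}).Nonempty)
    (hspan : Submodule.span ℝ (recCone (⋂ i, {x | ⟪a i, x⟫ ≤ b i})) = ⊤) :
    ∃ u, ∀ i, ⟪a i, u⟫ < 0 := by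
  cases nonempty_fintype ι
  have hex : ∀ i, ∃ y ∈ recCone (⋂ i, {x | ⟪a i, x⟫ ≤ b i}), ⟪a i, y⟫ < 0 := by
    intro i
    by_contra! h
    have hle : Submodule.span ℝ (recCone (⋂ i, {x | ⟪a i, x⟫ ≤ b i})) ≤
        LinearMap.ker (innerₛₗ ℝ (a i)) := by
      refine Submodule.span_le.2 fun y hy => ?_
      exact le_antisymm (inner_nonpos_of_mem_recCone hne hy i) (h y hy)
    rw [hspan] at hle
    have h0 : ⟪a i, a i⟫ = 0 := hle (Submodule.mem_top (x := a i))
    exact ha i (inner_self_eq_zero.1 h0)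
  choose y hy hneg using hex
  refine ⟨∑ j, y j, fun i => ?_⟩
  rw [inner_sum]
  exact Finset.sum_neg' (fun j _ => inner_nonpos_of_mem_recCone hne (hy j) i)
    ⟨i, Finset.mem_univ i, hneg i⟩

/-- an unbounded convex polyhedral set in `E^{l+1}` with full-dimensional
pointed recession cone meets every sufficiently large sphere around any fixed point in a
set homeomorphic to a closed `l`-dimensional ball. -/
theorem stmt6 (l : ℕ) (p : EuclideanSpace ℝ (Fin (l + 1)))
    (Q : Set (EuclideanSpace ℝ (Fin (l + 1))))
    (hpoly : ∃ (ι : Type) (_ : Fintype ι) (a : ι → EuclideanSpace ℝ (Fin (l + 1))) (b : ι → ℝ),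
      (∀ i, a i ≠ 0) ∧ Q = ⋂ i, {x | ⟪a i, x⟫ ≤ b i})
    (hub : ¬ Bornology.IsBounded Q)
    (hint : (interior Q).Nonempty)
    (hpointed : ∀ y ∈ recCone Q, -y ∈ recCone Q → y = 0)
    (hdim : Module.finrank ℝ (Submodule.span ℝ (recCone Q)) = l + 1) :
    ∃ s₀ > (0 : ℝ), ∀ s ≥ s₀,
      Set.extremePoints ℝ Q ⊆ ball p s ∧
      Nonempty ((sphere p s ∩ Q : Set (EuclideanSpace ℝ (Fin (l + 1)))) ≃ₜ
        (closedBall (0 : EuclideanSpace ℝ (Fin l)) 1 : Set (EuclideanSpace ℝ (Fin l)))) := by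
  obtain ⟨ι, _, a, b, ha, rfl⟩ := hpoly
  set Q := ⋂ i, {x | ⟪a i, x⟫ ≤ b i} with hQ
  have hne : Q.Nonempty := hint.mono interior_subset
  have hspan : Submodule.span ℝ (recCone Q) = ⊤ :=
    Submodule.eq_top_of_finrank_eq (by rw [hdim, finrank_euclideanSpace_fin])
  have hι : Nonempty ι := by
    by_contra hempty
    rw [not_nonempty_iff] at hempty
    have huniv : ∀ y, y ∈ recCone Q := fun y x _ c _ => by simp [hQ]
    obtain ⟨y, hy⟩ := exists_ne (0 : EuclideanSpace ℝ (Fin (l + 1)))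
    exact hy (hpointed y (huniv y) (huniv _))
  obtain ⟨u₀, hu₀⟩ := exists_forall_inner_neg ha hne hspan
  have hu₀ne : u₀ ≠ 0 := by
    rintro rfl
    simpa using hu₀ (Classical.arbitrary ι)
  obtain ⟨v, hv, hav⟩ : ∃ v : EuclideanSpace ℝ (Fin (l + 1)), ‖v‖ = 1 ∧ ∀ i, 0 < ⟪a i, v⟫ := by
    refine ⟨-(‖u₀‖⁻¹ • u₀), by simp [norm_smul, hu₀ne], fun i => ?_⟩
    rw [inner_neg_right, inner_smul_right, neg_pos]
    exact mul_neg_of_pos_of_neg (by positivity) (hu₀ i)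
  obtain ⟨R, hR⟩ := (finite_extremePoints_iInter_halfSpace a b).isBounded.subset_ball p
  have hev : ∀ᶠ s : ℝ in Filter.atTop, ∀ i, |b i - ⟪a i, p⟫| < ⟪a i, v⟫ * s := by
    rw [Filter.eventually_all]
    exact fun i => (Filter.tendsto_id.const_mul_atTop (hav i)).eventually_gt_atTop _
  obtain ⟨s₁, hs₁⟩ := Filter.eventually_atTop.1 hev
  refine ⟨max 1 (max R s₁), by positivity, fun s hs => ?_⟩
  obtain ⟨h1s, hs'⟩ := max_le_iff.1 hs
  obtain ⟨hRs, hs₁s⟩ := max_le_iff.1 hs'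
  have hs0 : 0 < s := by linarith
  refine ⟨hR.trans (ball_subset_ball hRs), ?_⟩
  have hbound : ∀ i, |(b i - ⟪a i, p⟫) / s| < ⟪a i, v⟫ := fun i => by
    rw [abs_div, abs_of_pos hs0, div_lt_iff₀ hs0]
    exact hs₁ s hs₁s i
  obtain ⟨e⟩ := nonempty_homeomorph_closedBall_of_caps (n := l) (by simp) hv
    (a := a) (β := fun i => (b i - ⟪a i, p⟫) / s)
    (fun i => (abs_lt.1 (hbound i)).2) (fun i => (abs_lt.1 (hbound i)).1)
  let φ : EuclideanSpace ℝ (Fin (l + 1)) ≃ₜ EuclideanSpace ℝ (Fin (l + 1)) :=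
    (Homeomorph.smulOfNeZero s hs0.ne').trans (Homeomorph.addLeft p)
  have hφ : ∀ z, φ z = p + s • z := fun _ => rfl
  have hpre : {z | ‖z‖ = 1 ∧ ∀ i, ⟪a i, z⟫ ≤ (b i - ⟪a i, p⟫) / s} = φ ⁻¹' (sphere p s ∩ Q) := by
    ext z
    simp only [mem_ofPred_eq, mem_preimage, mem_inter_iff, hφ, hQ, mem_iInter, mem_sphere_iff_norm,
      add_sub_cancel_left, norm_smul, Real.norm_of_nonneg hs0.le, inner_add_right, inner_smul_right,
      le_div_iff₀ hs0]
    refine and_congr (by simp [hs0.ne']) (forall_congr' fun i => ?_)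
    constructor <;> intro h <;> linarith
  have e' : (φ ⁻¹' (sphere p s ∩ Q) : Set _) ≃ₜ (sphere p s ∩ Q : Set _) :=
    (φ.image _).trans (.setCongr (φ.surjective.image_preimage _))
  exact ⟨e'.symm.trans ((Homeomorph.setCongr hpre.symm).trans e)⟩
end
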